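/- Every game filter on (ω)^ω is an scp-filter, i.e. every game filter has the segment colouring property. -/

import Mathlib

namespace DualRamsey

/-- A partition: a set of pairwise disjoint nonempty blocks (subsets of ℕ). -/
def IsPartition (P : Set (Set ℕ)) : Prop :=
  (∀ b ∈ P, b.Nonempty) ∧ ∀ b ∈ P, ∀ c ∈ P, b ≠ c → Disjoint b c

/-- The domain of a partition: the union of its blocks. -/
def pdom (P : Set (Set ℕ)) : Set ℕ := ⋃₀ P

/-- Membership in (ω)^ω : an infinite partition of ℕ. -/
def InfPart (X : Set (Set ℕ)) : Prop :=
  IsPartition X ∧ pdom X = Set.univ ∧ X.Infinite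

/-- Membership in (ℕ) : a partition whose domain is {0, …, n−1} for some n. -/
def FinPart (s : Set (Set ℕ)) : Prop :=
  IsPartition s ∧ ∃ n : ℕ, pdom s = Set.Iio n

/-- `Coarser P Q` means P ⊑ Q : P is coarser than Q, i.e. every block p of P satisfies
that p ∩ dom(Q) is a union of sets of the form q ∩ dom(P) with q a block of Q. -/
def Coarser (P Q : Set (Set ℕ)) : Prop :=
  ∀ p ∈ P, ∃ S ⊆ Q, p ∩ pdom Q = ⋃ q ∈ S, q ∩ pdom P

/-- `Segment s X` means s ⪯ X : for every block p of s there is a block q of X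
with p = q ∩ dom(s). -/
def Segment (s X : Set (Set ℕ)) : Prop :=
  ∀ p ∈ s, ∃ q ∈ X, p = q ∩ pdom s

/-- For s ∈ (ℕ) with dom(s) = {0,…,n−1}, this is the number n. -/
noncomputable def finBound (s : Set (Set ℕ)) : ℕ := sInf {n | pdom s = Set.Iio n}

/-- s* := s ∪ {{n}} where dom(s) = {0,…,n−1}. -/
noncomputable def sStar (s : Set (Set ℕ)) : Set (Set ℕ) := insert {finBound s} s

/-- The dual Ellentuck neighbourhood (s,X) := {Y ∈ (ω)^ω : s ⪯ Y and Y ⊑ X}. -/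
def EllNbhd (s X : Set (Set ℕ)) : Set (Set (Set ℕ)) :=
  {Y | InfPart Y ∧ Segment s Y ∧ Coarser Y X}

/-- (s,X)^n := {u ∈ (ℕ) : |u| = n, s ⪯ u, u* ⊑ X}. -/
def nseg (s X : Set (Set ℕ)) (n : ℕ) : Set (Set (Set ℕ)) :=
  {u | FinPart u ∧ u.ncard = n ∧ Segment s u ∧ Coarser (sStar u) X}

/-- (s,ω)^n := {u ∈ (ℕ) : |u| = n, s ⪯ u} (ω viewed as the partition into singletons). -/
def nsegOmega (s : Set (Set ℕ)) (n : ℕ) : Set (Set (Set ℕ)) :=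
  {u | FinPart u ∧ u.ncard = n ∧ Segment s u}

/-- a and b lie in a common block of P. -/
def sameBlock (P : Set (Set ℕ)) (a b : ℕ) : Prop := ∃ p ∈ P, a ∈ p ∧ b ∈ p

/-- P ⊓ Q : the finest partition coarser than both P and Q, with
dom(P ⊓ Q) = dom(P) ∪ dom(Q); its blocks are the classes of the equivalence
relation generated by "lying in a common block of P or of Q". -/
def pmeet (P Q : Set (Set ℕ)) : Set (Set ℕ) :=
  {b | ∃ a ∈ pdom P ∪ pdom Q,
    b = {c | Relation.EqvGen (fun u v => sameBlock P u v ∨ sameBlock Q u v) a c}}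

/-- P ⊑* Q : P is almost coarser than Q, i.e. there is a partition R with finite
domain such that R ⊓ P ⊑ Q. -/
def AlmostCoarser (P Q : Set (Set ℕ)) : Prop :=
  ∃ R, IsPartition R ∧ (pdom R).Finite ∧ Coarser (pmeet R P) Q

/-- A filter on (ω)^ω. -/
structure IsPFilter (F : Set (Set (Set ℕ))) : Prop where
  mem_infPart : ∀ X ∈ F, InfPart X
  empty_not_mem : ∅ ∉ F
  upward : ∀ X ∈ F, ∀ Y, InfPart Y → Coarser X Y → Y ∈ F
  meet_infPart : ∀ X ∈ F, ∀ Y ∈ F, InfPart (pmeet X Y)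
  meet_mem : ∀ X ∈ F, ∀ Y ∈ F, pmeet X Y ∈ F

/-- An ultrafilter on (ω)^ω : a filter not properly contained in any other filter. -/
def IsPUltrafilter (F : Set (Set (Set ℕ))) : Prop :=
  IsPFilter F ∧ ∀ G, IsPFilter G → F ⊆ G → F = G

/-- The segment colouring property. -/
def HasSCP (F : Set (Set (Set ℕ))) : Prop :=
  ∀ s, FinPart s → ∀ X ∈ F, Coarser s X → ∀ k r : ℕ, 1 ≤ s.ncard + k → 1 ≤ r →
    ∀ π : Set (Set ℕ) → ℕ, (∀ u ∈ nseg s X (s.ncard + k), π u < r) →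
      ∃ Y ∈ EllNbhd s X, Y ∈ F ∧
        ∀ u ∈ nseg s Y (s.ncard + k), ∀ v ∈ nseg s Y (s.ncard + k), π u = π v

/-- `IsLCondWith E p s Xw` : p is an L*_E-condition with stem s and witness family Xw. -/
def IsLCondWith (E : Set (Set (Set ℕ))) (p : Set (Set (Set ℕ))) (s : Set (Set ℕ))
    (Xw : Set (Set ℕ) → Set (Set ℕ)) : Prop :=
  (∀ t ∈ p, FinPart t) ∧
  s ∈ p ∧ (∀ t ∈ p, Segment s t) ∧
  (∀ t ∈ p, Xw t ∈ E) ∧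
  (∀ t ∈ p, Coarser (sStar t) (Xw t)) ∧
  (∀ t ∈ p, {u | u ∈ p ∧ Segment t u ∧ u.ncard = t.ncard + 1}
      = nseg (sStar t) (Xw t) (t.ncard + 1)) ∧
  (∀ t ∈ p, ∀ u ∈ p, Segment t u → EllNbhd u (Xw u) ⊆ EllNbhd t (Xw t)) ∧
  (∀ t ∈ p, ∀ u ∈ p, pdom t = pdom u → Coarser t u → Xw t = Xw u)

/-- X is a branch of the condition p with stem s. -/
def IsBranch (p : Set (Set (Set ℕ))) (s : Set (Set ℕ)) (X : Set (Set ℕ)) : Prop :=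
  ∀ t, FinPart t → Segment s t → Coarser (sStar t) X → t ∈ p

/-- F is diagonalizable: every L*_F-condition has a branch in F. -/
def Diagonalizable (F : Set (Set (Set ℕ))) : Prop :=
  ∀ p s Xw, IsLCondWith F p s Xw → ∃ X ∈ F, IsBranch p s X

/-- A Ramsey* ultrafilter: a diagonalizable scp-filter. -/
def RamseyStar (F : Set (Set (Set ℕ))) : Prop :=
  IsPFilter F ∧ HasSCP F ∧ Diagonalizable F

/-- O is F-open: a union of nonempty dual Ellentuck neighbourhoods (s,X) with X ∈ F. -/
def FOpen (F O : Set (Set (Set ℕ))) : Prop :=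
  ∃ I : Set ((Set (Set ℕ)) × (Set (Set ℕ))),
    (∀ q ∈ I, FinPart q.1 ∧ q.2 ∈ F ∧ (EllNbhd q.1 q.2).Nonempty) ∧
    O = ⋃ q ∈ I, EllNbhd q.1 q.2

/-- (s,X) is good with respect to the F-open set O. -/
def FGood (F O : Set (Set (Set ℕ))) (s X : Set (Set ℕ)) : Prop :=
  ∃ Y ∈ EllNbhd s X, Y ∈ F ∧ EllNbhd s Y ⊆ O

/-- (s,X) is ugly with respect to O: (t*,X) is bad for every t ∈ (ℕ) with
s ⪯ t*, t* ⊑ X and |t| = |s|. -/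
def FUgly (F O : Set (Set (Set ℕ))) (s X : Set (Set ℕ)) : Prop :=
  ∀ t, FinPart t → Segment s (sStar t) → Coarser (sStar t) X → t.ncard = s.ncard →
    ¬ FGood F O (sStar t) X

/-- p is uniform with uniformity witness X (X = cu(p)). -/
def UniformWith (F : Set (Set (Set ℕ))) (p : Set (Set (Set ℕ)))
    (Xw : Set (Set ℕ) → Set (Set ℕ)) (X : Set (Set ℕ)) : Prop :=
  X ∈ F ∧ ∀ t ∈ p, EllNbhd t X = EllNbhd t (Xw t)

/-- (X) := {Y ∈ (ω)^ω : Y ⊑ X}. -/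
def coarsenings (X : Set (Set ℕ)) : Set (Set (Set ℕ)) :=
  {Y | InfPart Y ∧ Coarser Y X}

/-- A ⊆ (ω)^ω has the dual Ramsey property. -/
def IsDualRamsey (A : Set (Set (Set ℕ))) : Prop :=
  ∃ X, InfPart X ∧ (coarsenings X ⊆ A ∨ coarsenings X ∩ A = ∅)

/-- A ⊆ (ω)^ω is completely dual Ramsey. -/
def CompletelyDualRamsey (A : Set (Set (Set ℕ))) : Prop :=
  ∀ s X, FinPart s → InfPart X → (EllNbhd s X).Nonempty →
    ∃ Y ∈ EllNbhd s X, (EllNbhd s Y ⊆ A ∨ EllNbhd s Y ∩ A = ∅)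

/- ### Coding between reals and partitions -/

/-- The hypotheses on the fixed pairing function ♭ : it is (induced by) a bijection
between two-element subsets of ℕ and ℕ. -/
def FlatBijection (flat : ℕ → ℕ → ℕ) : Prop :=
  (∀ m n, flat m n = flat n m) ∧
  (∀ a b c d, a ≠ b → c ≠ d → flat a b = flat c d → ({a, b} : Set ℕ) = {c, d}) ∧
  (∀ k, ∃ a b, a ≠ b ∧ flat a b = k)

/-- trans(x): the codes ♭({a,b}) of pairs {a,b} connected by a finite chain through x. -/
def ptrans (flat : ℕ → ℕ → ℕ) (x : Set ℕ) : Set ℕ :=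
  {k | ∃ m : ℕ, ∃ f : ℕ → ℕ, 1 ≤ m ∧ f 0 ≠ f m ∧ k = flat (f 0) (f m) ∧
    ∀ i < m, flat (f i) (f (i + 1)) ∈ x}

/-- The equivalence relation n ∼ m iff n = m or ♭({n,m}) ∈ trans(x). -/
def cpRel (flat : ℕ → ℕ → ℕ) (x : Set ℕ) (n m : ℕ) : Prop :=
  n = m ∨ flat n m ∈ ptrans flat x

/-- cp(x): the partition of ℕ whose blocks are the classes of cpRel. -/
def cp (flat : ℕ → ℕ → ℕ) (x : Set ℕ) : Set (Set ℕ) :=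
  {b | ∃ n : ℕ, b = {m | cpRel flat x n m}}

/-- pc(X): the partition code of X. -/
def pcode (flat : ℕ → ℕ → ℕ) (X : Set (Set ℕ)) : Set ℕ :=
  {k | ∃ n m, n ≠ m ∧ sameBlock X n m ∧ k = flat n m}

/- ### The game G_F -/

/-- A move of player I: a pair ⟨t, Y⟩. -/
abbrev MoveI := (Set (Set ℕ)) × (Set (Set ℕ))

/-- The play (t, Y, X) follows the strategy σ of player I (σ reads off the
previous moves of player II). -/
def Follows (σ : List (Set (Set ℕ)) → MoveI) (t Y X : ℕ → Set (Set ℕ)) : Prop :=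
  ∀ n, σ (List.ofFn fun i : Fin n => X i) = (t n, Y n)

/-- Player I's n-th move in the play (t,Y,X) is legal. -/
def LegalI (F : Set (Set (Set ℕ))) (t Y X : ℕ → Set (Set ℕ)) (n : ℕ) : Prop :=
  FinPart (t n) ∧ Y n ∈ F ∧ (EllNbhd (sStar (t n)) (Y n)).Nonempty ∧
  ∀ m, n = m + 1 →
    Segment (sStar (t m)) (sStar (t n)) ∧ Coarser (sStar (t n)) (X m) ∧
    (t n).ncard = (t m).ncard + 1

/-- Player II's n-th move in the play (t,Y,X) is legal. -/
def LegalII (F : Set (Set (Set ℕ))) (t Y X : ℕ → Set (Set ℕ)) (n : ℕ) : Prop :=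
  X n ∈ F ∧ X n ∈ EllNbhd (sStar (t n)) (Y n)

/-- σ is a winning strategy for player I in G_F: against legal play of II it always
produces legal moves, and in every legal play following σ player I wins, i.e. any
Y ∈ (ω)^ω with t_n ⪯ Y for all n is not in F. -/
def WinningStratI (F : Set (Set (Set ℕ))) (σ : List (Set (Set ℕ)) → MoveI) : Prop :=
  ∀ t Y X, Follows σ t Y X →
    (∀ n, (∀ m < n, LegalII F t Y X m) → LegalI F t Y X n) ∧
    ((∀ n, LegalII F t Y X n) →
      ∀ Z, InfPart Z → (∀ n, Segment (t n) Z) → Z ∉ F)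

/-- A game filter: an ultrafilter such that player I has no winning strategy in G_F. -/
def GameFilter (F : Set (Set (Set ℕ))) : Prop :=
  IsPUltrafilter F ∧ ∀ σ, ¬ WinningStratI F σ

/- ### Density notions for the appendix -/

/-- (t)^0_s := {u ∈ (ℕ) : dom(u) = dom(t), s ⪯ u, u ⊑ t, |u| = |s|}. -/
def iseg0 (s t : Set (Set ℕ)) : Set (Set (Set ℕ)) :=
  {u | FinPart u ∧ pdom u = pdom t ∧ Segment s u ∧ Coarser u t ∧ u.ncard = s.ncard}

/-- K ⊆ (ℕ) is dense in (t,X): for every Y ∈ (t,X) ∩ F there is u ∈ K with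
t ⪯ u* and u* ⊑ Y. -/
def DenseIn (F : Set (Set (Set ℕ))) (K : Set (Set (Set ℕ))) (t X : Set (Set ℕ)) : Prop :=
  ∀ Y ∈ EllNbhd t X, Y ∈ F → ∃ u ∈ K, Segment t (sStar u) ∧ Coarser (sStar u) Y

/-- D is 0-dense in (X)^{0*}_s: for every Y ∈ (s,X) ∩ F there is u ∈ D with
s ⪯ u* and u* ⊑ Y. -/
def ZeroDense (F : Set (Set (Set ℕ))) (D : Set (Set (Set ℕ))) (s X : Set (Set ℕ)) : Prop :=
  ∀ Y ∈ EllNbhd s X, Y ∈ F → ∃ u ∈ D, Segment s (sStar u) ∧ Coarser (sStar u) Y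

/-- (t,X)^{k*}_s := {u ∈ (ℕ) : t ⪯ u*, u* ⊑ X, |u| = |s| + k}. -/
def tseg (s t X : Set (Set ℕ)) (k : ℕ) : Set (Set (Set ℕ)) :=
  {u | FinPart u ∧ Segment t (sStar u) ∧ Coarser (sStar u) X ∧ u.ncard = s.ncard + k}

/-- E is k-dense in (t,X)^{k*}_s: for every Y ∈ (t,X) ∩ F, (t,Y)^{k*}_s ∩ E ≠ ∅. -/
def KDense (F : Set (Set (Set ℕ))) (E : Set (Set (Set ℕ))) (s t X : Set (Set ℕ))
    (k : ℕ) : Prop :=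
  ∀ Y ∈ EllNbhd t X, Y ∈ F → (tseg s t Y k ∩ E).Nonempty

section Basics

variable {P Q R s t u v w X Y Z : Set (Set ℕ)} {a b c N : ℕ}

lemma sameBlock.symm (h : sameBlock P a b) : sameBlock P b a := by
  obtain ⟨p, hp, ha, hb⟩ := h
  exact ⟨p, hp, hb, ha⟩

lemma IsPartition.trans (hP : IsPartition P) (h : sameBlock P a b) (h' : sameBlock P b c) :
    sameBlock P a c := by
  obtain ⟨p, hp, ha, hb⟩ := h
  obtain ⟨q, hq, hb', hc⟩ := h'
  have hpq : p = q := by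
    by_contra hne
    exact Set.disjoint_left.1 (hP.2 p hp q hq hne) hb hb'
  exact ⟨p, hp, ha, hpq ▸ hc⟩

lemma sameBlock_refl (h : a ∈ pdom P) : sameBlock P a a := by
  obtain ⟨p, hp, ha⟩ := h
  exact ⟨p, hp, ha, ha⟩

lemma sameBlock.left_mem (h : sameBlock P a b) : a ∈ pdom P := by
  obtain ⟨p, hp, ha, -⟩ := h
  exact ⟨p, hp, ha⟩

lemma sameBlock.right_mem (h : sameBlock P a b) : b ∈ pdom P := h.symm.left_mem

lemma IsPartition.mem_block (hP : IsPartition P) {p : Set ℕ} (hp : p ∈ P) (ha : a ∈ p)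
    (h : sameBlock P a b) : b ∈ p := by
  obtain ⟨q, hq, ha', hb⟩ := h
  have hpq : p = q := by
    by_contra hne
    exact Set.disjoint_left.1 (hP.2 p hp q hq hne) ha ha'
  exact hpq ▸ hb

lemma coarser_iff (hP : IsPartition P) (hQ : IsPartition Q) :
    Coarser P Q ↔ ∀ a ∈ pdom P, ∀ b ∈ pdom P, sameBlock Q a b → sameBlock P a b := by
  constructor
  · rintro h a ⟨p, hp, ha⟩ b hb hab
    obtain ⟨S, hS, hpS⟩ := h p hp
    have ha' : a ∈ p ∩ pdom Q := ⟨ha, hab.left_mem⟩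
    rw [hpS] at ha'
    simp only [Set.mem_iUnion, exists_prop] at ha'
    obtain ⟨q, hq, haq, -⟩ := ha'
    have hb' : b ∈ ⋃ q ∈ S, q ∩ pdom P :=
      Set.mem_biUnion hq ⟨hQ.mem_block (hS hq) haq hab, hb⟩
    rw [← hpS] at hb'
    exact ⟨p, hp, ha, hb'.1⟩
  · intro h p hp
    refine ⟨{q ∈ Q | (p ∩ q).Nonempty}, fun q hq => hq.1, ?_⟩
    ext x
    simp only [Set.mem_inter_iff, Set.mem_iUnion, Set.mem_ofPred_eq, exists_prop]
    constructor
    · rintro ⟨hx, q, hq, hxq⟩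
      exact ⟨q, ⟨hq, x, hx, hxq⟩, hxq, p, hp, hx⟩
    · rintro ⟨q, ⟨hq, y, hyp, hyq⟩, hxq, hxP⟩
      exact ⟨hP.mem_block hp hyp (h y ⟨p, hp, hyp⟩ x hxP ⟨q, hq, hyq, hxq⟩), q, hq, hxq⟩

lemma segment_iff (hs : IsPartition s) (hX : IsPartition X) :
    Segment s X ↔ pdom s ⊆ pdom X ∧
      ∀ a ∈ pdom s, ∀ b ∈ pdom s, (sameBlock s a b ↔ sameBlock X a b) := by
  constructor
  · intro h
    constructor
    · rintro a ⟨p, hp, ha⟩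
      obtain ⟨q, hq, rfl⟩ := h p hp
      exact ⟨q, hq, ha.1⟩
    · rintro a ⟨p, hp, ha⟩ b hb
      obtain ⟨q, hq, hpq⟩ := h p hp
      constructor
      · intro hab
        have hbp := hs.mem_block hp ha hab
        rw [hpq] at ha hbp
        exact ⟨q, hq, ha.1, hbp.1⟩
      · intro hab
        have haq : a ∈ q := by rw [hpq] at ha; exact ha.1
        refine ⟨p, hp, ha, ?_⟩
        rw [hpq]
        exact ⟨hX.mem_block hq haq hab, hb⟩
  · rintro ⟨hd, h⟩ p hp
    obtain ⟨a, ha⟩ := hs.1 p hp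
    obtain ⟨q, hq, haq⟩ := hd ⟨p, hp, ha⟩
    refine ⟨q, hq, ?_⟩
    ext x
    constructor
    · intro hx
      exact ⟨hX.mem_block hq haq ((h a ⟨p, hp, ha⟩ x ⟨p, hp, hx⟩).1 ⟨p, hp, ha, hx⟩), p, hp, hx⟩
    · rintro ⟨hx, hxs⟩
      exact hs.mem_block hp ha ((h a ⟨p, hp, ha⟩ x hxs).2 ⟨q, hq, haq, hx⟩)

lemma eq_of_sameBlock_iff (hP : IsPartition P) (hQ : IsPartition Q) (hd : pdom P = pdom Q)
    (h : ∀ a ∈ pdom P, ∀ b ∈ pdom P, (sameBlock P a b ↔ sameBlock Q a b)) : P = Q := by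
  have key : ∀ {P Q : Set (Set ℕ)}, IsPartition P → IsPartition Q → pdom P = pdom Q →
      (∀ a ∈ pdom P, ∀ b ∈ pdom P, (sameBlock P a b ↔ sameBlock Q a b)) → P ⊆ Q := by
    intro P Q hP hQ hd h p hp
    obtain ⟨q, hq, hpq⟩ := (segment_iff hP hQ).2 ⟨hd.subset, h⟩ p hp
    have : q ⊆ pdom P := fun x hx => hd ▸ ⟨q, hq, hx⟩
    rw [Set.inter_eq_left.2 this] at hpq
    exact hpq ▸ hq
  refine (key hP hQ hd h).antisymm (key hQ hP hd.symm fun a ha b hb => ?_)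
  rw [← hd] at ha hb
  exact (h a ha b hb).symm

/-- The partition of `D` into the classes of the relation `r`. -/
def mkPart (D : Set ℕ) (r : ℕ → ℕ → Prop) : Set (Set ℕ) :=
  {b | ∃ a ∈ D, b = {c | c ∈ D ∧ r a c}}

/-- `r` is an equivalence relation on `D`. -/
structure EquivOn (D : Set ℕ) (r : ℕ → ℕ → Prop) : Prop where
  refl : ∀ a ∈ D, r a a
  symm : ∀ a b, r a b → r b a
  trans : ∀ a b c, r a b → r b c → r a c

section mkPart

variable {D : Set ℕ} {r : ℕ → ℕ → Prop}

lemma isPartition_mkPart (hr : EquivOn D r) : IsPartition (mkPart D r) := by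
  constructor
  · rintro _ ⟨a, ha, rfl⟩
    exact ⟨a, ha, hr.refl a ha⟩
  · rintro _ ⟨a, ha, rfl⟩ _ ⟨b, hb, rfl⟩ hne
    rw [Set.disjoint_left]
    rintro c ⟨hc, hac⟩ ⟨-, hbc⟩
    apply hne
    have hab := hr.trans _ _ _ hac (hr.symm _ _ hbc)
    ext x
    exact ⟨fun h => ⟨h.1, hr.trans _ _ _ (hr.symm _ _ hab) h.2⟩,
      fun h => ⟨h.1, hr.trans _ _ _ hab h.2⟩⟩

lemma pdom_mkPart (hr : EquivOn D r) : pdom (mkPart D r) = D := by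
  ext a
  constructor
  · rintro ⟨_, ⟨b, hb, rfl⟩, ha⟩
    exact ha.1
  · intro ha
    exact ⟨_, ⟨a, ha, rfl⟩, ha, hr.refl a ha⟩

lemma sameBlock_mkPart (hr : EquivOn D r) :
    sameBlock (mkPart D r) a b ↔ a ∈ D ∧ b ∈ D ∧ r a b := by
  constructor
  · rintro ⟨_, ⟨c, hc, rfl⟩, ha, hb⟩
    exact ⟨ha.1, hb.1, hr.trans _ _ _ (hr.symm _ _ ha.2) hb.2⟩
  · rintro ⟨ha, hb, hab⟩
    exact ⟨_, ⟨a, ha, rfl⟩, ⟨ha, hr.refl a ha⟩, hb, hab⟩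

end mkPart

/-! ### Finite partitions -/

lemma finBound_eq (h : pdom s = Set.Iio N) : finBound s = N := by
  have : {n | pdom s = Set.Iio n} = {N} := by
    ext n
    simp only [Set.mem_ofPred_eq, Set.mem_singleton_iff, h]
    exact ⟨fun h => (Set.Iio_injective h).symm, fun h => h ▸ rfl⟩
  rw [finBound, this, csInf_singleton]

lemma FinPart.pdom_eq (hs : FinPart s) : pdom s = Set.Iio (finBound s) := by
  obtain ⟨-, n, hn⟩ := hs
  rw [finBound_eq hn, hn]

lemma FinPart.mem_pdom (hs : FinPart s) : a ∈ pdom s ↔ a < finBound s := by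
  rw [hs.pdom_eq, Set.mem_Iio]

lemma FinPart.refl (hs : FinPart s) (h : a < finBound s) : sameBlock s a a :=
  sameBlock_refl (hs.mem_pdom.2 h)

lemma FinPart.lt (hs : FinPart s) (h : sameBlock s a b) : a < finBound s ∧ b < finBound s :=
  ⟨hs.mem_pdom.1 h.left_mem, hs.mem_pdom.1 h.right_mem⟩

lemma FinPart.finite (hs : FinPart s) : s.Finite := by
  refine ((Set.finite_Iio (finBound s)).finite_subsets).subset fun p hp x hx => ?_
  exact hs.mem_pdom.1 ⟨p, hp, hx⟩

lemma finPart_mkPart {r : ℕ → ℕ → Prop} (hr : EquivOn (Set.Iio N) r) :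
    FinPart (mkPart (Set.Iio N) r) :=
  ⟨isPartition_mkPart hr, N, pdom_mkPart hr⟩

lemma finBound_mkPart {r : ℕ → ℕ → Prop} (hr : EquivOn (Set.Iio N) r) :
    finBound (mkPart (Set.Iio N) r) = N :=
  finBound_eq (pdom_mkPart hr)

lemma FinPart.eq_of_sameBlock_iff (hs : FinPart s) (ht : FinPart t)
    (hd : finBound s = finBound t)
    (h : ∀ a < finBound s, ∀ b < finBound s, (sameBlock s a b ↔ sameBlock t a b)) : s = t := by
  refine DualRamsey.eq_of_sameBlock_iff hs.1 ht.1 (by rw [hs.pdom_eq, ht.pdom_eq, hd]) ?_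
  simpa only [hs.mem_pdom] using h

lemma FinPart.coarser_iff (hs : FinPart s) (hX : IsPartition X) :
    Coarser s X ↔ ∀ a < finBound s, ∀ b < finBound s, sameBlock X a b → sameBlock s a b := by
  rw [DualRamsey.coarser_iff hs.1 hX]
  simp only [hs.mem_pdom]

lemma pdom_sStar (hs : FinPart s) : pdom (sStar s) = Set.Iio (finBound s + 1) := by
  have h : pdom (sStar s) = {finBound s} ∪ pdom s := Set.sUnion_insert _ _
  rw [h, hs.pdom_eq]
  ext x
  simp only [Set.mem_union, Set.mem_singleton_iff, Set.mem_Iio]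
  omega

lemma finBound_sStar (hs : FinPart s) : finBound (sStar s) = finBound s + 1 :=
  finBound_eq (pdom_sStar hs)

lemma FinPart.sStar (hs : FinPart s) : FinPart (sStar s) := by
  refine ⟨⟨?_, ?_⟩, _, pdom_sStar hs⟩
  · rintro b (rfl | hb)
    · exact Set.singleton_nonempty _
    · exact hs.1.1 b hb
  · have key : ∀ b ∈ s, Disjoint {finBound s} b := by
      intro b hb
      rw [Set.disjoint_singleton_left]
      intro h
      exact lt_irrefl _ (hs.mem_pdom.1 ⟨b, hb, h⟩)
    rintro b (rfl | hb) c (rfl | hc) hne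
    · exact absurd rfl hne
    · exact key c hc
    · exact (key b hb).symm
    · exact hs.1.2 b hb c hc hne

lemma sameBlock_sStar :
    sameBlock (sStar s) a b ↔ sameBlock s a b ∨ (a = finBound s ∧ b = finBound s) := by
  constructor
  · rintro ⟨p, rfl | hp, ha, hb⟩
    · exact Or.inr ⟨ha, hb⟩
    · exact Or.inl ⟨p, hp, ha, hb⟩
  · rintro (⟨p, hp, ha, hb⟩ | ⟨rfl, rfl⟩)
    · exact ⟨p, Or.inr hp, ha, hb⟩
    · exact ⟨_, Or.inl rfl, rfl, rfl⟩

lemma ncard_sStar (hs : FinPart s) : (sStar s).ncard = s.ncard + 1 := by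
  refine Set.ncard_insert_of_notMem (fun h => ?_) hs.finite
  exact lt_irrefl _ (hs.mem_pdom.1 ⟨_, h, rfl⟩)

lemma FinPart.segment_iff (hs : FinPart s) (hu : FinPart u) :
    Segment s u ↔ finBound s ≤ finBound u ∧
      ∀ a < finBound s, ∀ b < finBound s, (sameBlock s a b ↔ sameBlock u a b) := by
  rw [DualRamsey.segment_iff hs.1 hu.1, hs.pdom_eq, hu.pdom_eq, Set.Iio_subset_Iio_iff]
  rfl

lemma Segment.le (h : Segment s u) (hs : FinPart s) (hu : FinPart u) :
    finBound s ≤ finBound u := ((hs.segment_iff hu).1 h).1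

lemma Segment.iff (h : Segment s X) (hs : FinPart s) (hX : IsPartition X)
    (ha : a < finBound s) (hb : b < finBound s) : sameBlock s a b ↔ sameBlock X a b :=
  ((DualRamsey.segment_iff hs.1 hX).1 h).2 a (hs.mem_pdom.2 ha) b (hs.mem_pdom.2 hb)

lemma Segment.mono (h : Segment s X) (hs : FinPart s) (hX : IsPartition X)
    (hab : sameBlock s a b) : sameBlock X a b :=
  (h.iff hs hX (hs.lt hab).1 (hs.lt hab).2).1 hab

lemma Segment.trans (h : Segment s t) (h' : Segment t X) (hs : FinPart s) (ht : FinPart t)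
    (hX : IsPartition X) : Segment s X := by
  rw [DualRamsey.segment_iff hs.1 hX]
  obtain ⟨hd, hst⟩ := (DualRamsey.segment_iff hs.1 ht.1).1 h
  obtain ⟨hd', htX⟩ := (DualRamsey.segment_iff ht.1 hX).1 h'
  exact ⟨hd.trans hd', fun a ha b hb => (hst a ha b hb).trans (htX a (hd ha) b (hd hb))⟩

lemma segment_refl (hs : FinPart s) : Segment s s :=
  (hs.segment_iff hs).2 ⟨le_rfl, fun _ _ _ _ => Iff.rfl⟩

lemma segment_sStar (hs : FinPart s) : Segment s (sStar s) := by
  rw [hs.segment_iff hs.sStar, finBound_sStar hs]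
  refine ⟨Nat.le_succ _, fun a ha b hb => ?_⟩
  rw [sameBlock_sStar]
  exact ⟨Or.inl, fun h => h.resolve_right fun h => by omega⟩

lemma Segment.coarser (h : Segment s X) (hs : FinPart s) (hX : IsPartition X) :
    Coarser s X :=
  (hs.coarser_iff hX).2 fun _ ha _ hb hab => (h.iff hs hX ha hb).2 hab

/-- A segment of the same cardinality is one in which every element lies in an old block. -/
lemma ncard_eq_iff (hs : FinPart s) (hu : FinPart u) (h : Segment s u) :
    u.ncard = s.ncard ↔ ∀ a < finBound u, ∃ b < finBound s, sameBlock u a b := by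
  choose! f hfu hf using h
  have hinj : Set.InjOn f s := by
    intro p hp q hq hpq
    rw [hf p hp, hf q hq, hpq]
  have himg : f '' s ⊆ u := by
    rintro _ ⟨p, hp, rfl⟩
    exact hfu p hp
  have hcard : u.ncard = s.ncard ↔ f '' s = u := by
    rw [← hinj.ncard_image]
    constructor
    · intro h
      exact Set.eq_of_subset_of_ncard_le himg h.le hu.finite
    · intro h
      rw [h]
  rw [hcard]
  constructor
  · intro himg a ha
    obtain ⟨q, hq, haq⟩ := hu.mem_pdom.2 ha
    obtain ⟨p, hp, rfl⟩ := himg.symm ▸ hq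
    obtain ⟨b, hb⟩ := hs.1.1 p hp
    refine ⟨b, hs.mem_pdom.1 ⟨p, hp, hb⟩, f p, hq, haq, ?_⟩
    rw [hf p hp] at hb
    exact hb.1
  · intro h
    refine himg.antisymm fun q hq => ?_
    obtain ⟨a, ha⟩ := hu.1.1 q hq
    obtain ⟨b, hb, hab⟩ := h a (hu.mem_pdom.1 ⟨q, hq, ha⟩)
    obtain ⟨p, hp, hbp⟩ := hs.mem_pdom.2 hb
    refine ⟨p, hp, ?_⟩
    have hbf : b ∈ f p := by
      rw [hf p hp] at hbp
      exact hbp.1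
    by_contra hne
    exact Set.disjoint_left.1 (hu.1.2 _ (hfu p hp) q hq hne) hbf (hu.1.mem_block hq ha hab)

/-- `u` prolongs `s` without introducing new blocks. -/
structure Ext (s u : Set (Set ℕ)) : Prop where
  base : FinPart s
  fin : FinPart u
  seg : Segment s u
  old : ∀ a < finBound u, ∃ b < finBound s, sameBlock u a b

lemma Ext.ncard (h : Ext s u) : u.ncard = s.ncard :=
  (ncard_eq_iff h.base h.fin h.seg).2 h.old

lemma ext_of_ncard (hs : FinPart s) (hu : FinPart u) (h : Segment s u)
    (hc : u.ncard = s.ncard) : Ext s u :=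
  ⟨hs, hu, h, (ncard_eq_iff hs hu h).1 hc⟩

lemma Ext.trans (h : Ext s t) (h' : Ext t u) : Ext s u :=
  ext_of_ncard h.base h'.fin (h.seg.trans h'.seg h.base h.fin h'.fin.1)
    (h'.ncard.trans h.ncard)

/-- A partition that prolongs `s` and is coarser than an extension `v` of `s` without new blocks
agrees with `v`. -/
lemma Ext.sameBlock_of_coarser (h : Ext s v) (hQ : IsPartition Q) (hsQ : Segment s Q)
    (hle : ∀ a b, sameBlock v a b → sameBlock Q a b) (ha : a < finBound v) (hb : b < finBound v)
    (hab : sameBlock Q a b) : sameBlock v a b := by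
  obtain ⟨a', ha', haa⟩ := h.old a ha
  obtain ⟨b', hb', hbb⟩ := h.old b hb
  have h1 : sameBlock Q a' b' :=
    hQ.trans (hle _ _ haa).symm (hQ.trans hab (hle _ _ hbb))
  have h2 : sameBlock v a' b' :=
    h.seg.mono h.base h.fin.1 ((hsQ.iff h.base hQ ha' hb').2 h1)
  exact h.fin.1.trans haa (h.fin.1.trans h2 hbb.symm)

lemma mem_nseg_iff (hs : FinPart s) :
    u ∈ nseg s X s.ncard ↔ Ext s u ∧ Coarser (sStar u) X :=
  ⟨fun h => ⟨ext_of_ncard hs h.1 h.2.2.1 h.2.1, h.2.2.2⟩,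
    fun h => ⟨h.1.fin, h.1.ncard, h.1.seg, h.2⟩⟩

lemma mem_iseg0_iff (hs : FinPart s) (ht : FinPart t) :
    u ∈ iseg0 s t ↔ Ext s u ∧ finBound u = finBound t ∧
      ∀ a b, sameBlock t a b → sameBlock u a b := by
  constructor
  · rintro ⟨hu, hd, hsu, hut, hc⟩
    have hd' : finBound u = finBound t := finBound_eq (hd.trans ht.pdom_eq)
    refine ⟨ext_of_ncard hs hu hsu hc, hd', fun a b hab => ?_⟩
    have := ht.lt hab
    exact (hu.coarser_iff ht.1).1 hut a (by omega) b (by omega) hab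
  · rintro ⟨he, hd, hut⟩
    exact ⟨he.fin, by rw [he.fin.pdom_eq, ht.pdom_eq, hd], he.seg,
      (he.fin.coarser_iff ht.1).2 fun a _ b _ hab => hut a b hab, he.ncard⟩

lemma finite_iseg0 (ht : FinPart t) : (iseg0 s t).Finite := by
  refine ((Set.finite_Iio (finBound t)).finite_subsets.finite_subsets).subset ?_
  rintro u ⟨-, hd, -⟩ p hp x hx
  have : x ∈ pdom u := ⟨p, hp, hx⟩
  rwa [hd, ht.pdom_eq] at this

/-! ### Infinite partitions -/

lemma InfPart.refl (hX : InfPart X) (a : ℕ) : sameBlock X a a :=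
  sameBlock_refl (by rw [hX.2.1]; trivial)

/-- `m` is the least element of its block. -/
def IsBlockMin (X : Set (Set ℕ)) (m : ℕ) : Prop := ∀ b < m, ¬ sameBlock X b m

lemma infinite_iff (hX : IsPartition X) (hd : pdom X = Set.univ) :
    X.Infinite ↔ ∀ n, ∃ m ≥ n, IsBlockMin X m := by
  constructor
  · intro h n
    by_contra! hn
    apply h
    refine ((Set.finite_Iio n).image fun a => {c | sameBlock X a c}).subset ?_
    have hsmall : ∀ a, ∃ b < n, sameBlock X b a := by
      intro a
      induction a using Nat.strong_induction_on with
      | _ a ih =>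
        rcases lt_or_ge a n with han | han
        · exact ⟨a, han, sameBlock_refl (by rw [hd]; trivial)⟩
        · have := hn a han
          unfold IsBlockMin at this
          push Not at this
          obtain ⟨b, hb, hba⟩ := this
          obtain ⟨c, hc, hcb⟩ := ih b hb
          exact ⟨c, hc, hX.trans hcb hba⟩
    intro p hp
    obtain ⟨a, ha⟩ := hX.1 p hp
    obtain ⟨b, hb, hba⟩ := hsmall a
    refine ⟨b, hb, ?_⟩
    have hbp := hX.mem_block hp ha hba.symm
    ext c
    exact ⟨fun h => hX.mem_block hp hbp h, fun h => ⟨p, hp, hbp, h⟩⟩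
  · intro h
    have hinf : {m | IsBlockMin X m}.Infinite := by
      rw [Set.infinite_iff_exists_gt]
      intro n
      obtain ⟨m, hm, hX⟩ := h (n + 1)
      exact ⟨m, hX, hm⟩
    have hex : ∀ m, ∃ p ∈ X, m ∈ p := fun m => by
      have : m ∈ pdom X := by rw [hd]; trivial
      exact this
    choose f hfX hf using hex
    refine Set.infinite_of_injOn_mapsTo (f := f) ?_ (fun m _ => hfX m) hinf
    intro m hm m' hm' hmm
    have hs : sameBlock X m m' := ⟨f m, hfX m, hf m, hmm ▸ hf m'⟩
    rcases lt_trichotomy m m' with hlt | heq | hlt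
    · exact absurd hs (hm' m hlt)
    · exact heq
    · exact absurd hs.symm (hm m' hlt)

lemma InfPart.exists_isBlockMin (hX : InfPart X) (n : ℕ) : ∃ m ≥ n, IsBlockMin X m :=
  (infinite_iff hX.1 hX.2.1).1 hX.2.2 n

lemma infPart_mkPart {r : ℕ → ℕ → Prop} (hr : EquivOn Set.univ r)
    (h : ∀ n, ∃ m ≥ n, ∀ b < m, ¬ r b m) : InfPart (mkPart Set.univ r) := by
  refine ⟨isPartition_mkPart hr, pdom_mkPart hr, ?_⟩
  rw [infinite_iff (isPartition_mkPart hr) (pdom_mkPart hr)]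
  simpa [IsBlockMin, sameBlock_mkPart hr] using h

lemma sameBlock_mkPart_univ {r : ℕ → ℕ → Prop} (hr : EquivOn Set.univ r) :
    sameBlock (mkPart Set.univ r) a b ↔ r a b := by
  simp [sameBlock_mkPart hr]

lemma InfPart.coarser_iff (hY : InfPart Y) (hX : IsPartition X) :
    Coarser Y X ↔ ∀ a b, sameBlock X a b → sameBlock Y a b := by
  rw [DualRamsey.coarser_iff hY.1 hX, hY.2.1]
  simp

lemma InfPart.segment_iff (hX : InfPart X) (hs : FinPart s) :
    Segment s X ↔ ∀ a < finBound s, ∀ b < finBound s, (sameBlock s a b ↔ sameBlock X a b) := by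
  rw [DualRamsey.segment_iff hs.1 hX.1, hX.2.1]
  simp [hs.mem_pdom]

lemma InfPart.coarser_refl (hX : InfPart X) : Coarser X X :=
  (hX.coarser_iff hX.1).2 fun _ _ h => h

lemma Coarser.trans (h : Coarser P Y) (h' : Coarser Y X) (hP : IsPartition P) (hY : InfPart Y)
    (hX : IsPartition X) : Coarser P X := by
  rw [DualRamsey.coarser_iff hP hX]
  intro a ha b hb hab
  exact (DualRamsey.coarser_iff hP hY.1).1 h a ha b hb ((hY.coarser_iff hX).1 h' a b hab)

end Basics

section Filters

variable {P Q R s t u v w X Y Z : Set (Set ℕ)} {a b c N : ℕ} {F : Set (Set (Set ℕ))}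

lemma pmeet_eq (hX : pdom X = Set.univ) : pmeet X Y =
    mkPart Set.univ (Relation.EqvGen fun u v => sameBlock X u v ∨ sameBlock Y u v) := by
  simp [pmeet, mkPart, hX]

lemma equivOn_eqvGen (r : ℕ → ℕ → Prop) : EquivOn Set.univ (Relation.EqvGen r) :=
  ⟨fun a _ => .refl a, fun _ _ h => .symm _ _ h, fun _ _ _ h h' => .trans _ _ _ h h'⟩

lemma sameBlock_pmeet (hX : pdom X = Set.univ) : sameBlock (pmeet X Y) a b ↔
    Relation.EqvGen (fun u v => sameBlock X u v ∨ sameBlock Y u v) a b := by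
  rw [pmeet_eq hX, sameBlock_mkPart_univ (equivOn_eqvGen _)]

lemma isPartition_pmeet (hX : pdom X = Set.univ) : IsPartition (pmeet X Y) := by
  rw [pmeet_eq hX]
  exact isPartition_mkPart (equivOn_eqvGen _)

lemma sameBlock_pmeet_left (hX : pdom X = Set.univ) (h : sameBlock X a b) :
    sameBlock (pmeet X Y) a b :=
  (sameBlock_pmeet hX).2 (.rel _ _ (Or.inl h))

lemma sameBlock_pmeet_right (hX : pdom X = Set.univ) (h : sameBlock Y a b) :
    sameBlock (pmeet X Y) a b :=
  (sameBlock_pmeet hX).2 (.rel _ _ (Or.inr h))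

/-- A relation closed under chains holds on the blocks of a meet. -/
lemma pmeet_le {r : ℕ → ℕ → Prop} (hr : EquivOn Set.univ r) (hX : pdom X = Set.univ)
    (h₁ : ∀ a b, sameBlock X a b → r a b) (h₂ : ∀ a b, sameBlock Y a b → r a b)
    (h : sameBlock (pmeet X Y) a b) : r a b := by
  rw [sameBlock_pmeet hX] at h
  induction h with
  | rel x y h => exact h.elim (h₁ x y) (h₂ x y)
  | refl x => exact hr.refl x trivial
  | symm x y _ ih => exact hr.symm _ _ ih
  | trans x y z _ _ ih ih' => exact hr.trans _ _ _ ih ih'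

lemma InfPart.equivOn (hX : InfPart X) : EquivOn Set.univ (sameBlock X) :=
  ⟨fun a _ => hX.refl a, fun _ _ h => h.symm, fun _ _ _ h h' => hX.1.trans h h'⟩

lemma infPart_of_finer (hX : InfPart X) (hY : IsPartition Y) (hd : pdom Y = Set.univ)
    (h : ∀ a b, sameBlock Y a b → sameBlock X a b) : InfPart Y := by
  refine ⟨hY, hd, (infinite_iff hY hd).2 fun n => ?_⟩
  obtain ⟨m, hm, hmin⟩ := hX.exists_isBlockMin n
  exact ⟨m, hm, fun b hb hbm => hmin b hb (h _ _ hbm)⟩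

/-- A partition that arises from a member of an ultrafilter by gluing only blocks that meet a
finite set belongs to the ultrafilter. -/
lemma mem_of_finite_gluing (hF : IsPUltrafilter F) (hY : Y ∈ F) (hZ : InfPart Z)
    (h : ∀ a b, sameBlock Z a b →
      sameBlock Y a b ∨ ((∃ x < N, sameBlock Y a x) ∧ ∃ x < N, sameBlock Y b x)) : Z ∈ F := by
  obtain ⟨hf, hmax⟩ := hF
  have hinf : ∀ W ∈ F, InfPart (pmeet W Z) := by
    intro W hW
    have hWd := (hf.mem_infPart W hW).2.1
    have hM := hf.meet_infPart W hW Y hY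
    set M := pmeet W Y with hMdef
    have hr : EquivOn Set.univ fun a b =>
        sameBlock M a b ∨ ((∃ x < N, sameBlock M a x) ∧ ∃ x < N, sameBlock M b x) := by
      refine ⟨fun a _ => Or.inl (hM.refl a), ?_, ?_⟩
      · rintro a b (h | ⟨h, h'⟩)
        · exact Or.inl h.symm
        · exact Or.inr ⟨h', h⟩
      · rintro a b c (h | ⟨h, ⟨y, hy, hby⟩⟩) (k | ⟨⟨x, hx, hbx⟩, k⟩)
        · exact Or.inl (hM.1.trans h k)
        · exact Or.inr ⟨⟨x, hx, hM.1.trans h hbx⟩, k⟩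
        · exact Or.inr ⟨h, y, hy, hM.1.trans k.symm hby⟩
        · exact Or.inr ⟨h, k⟩
    have hdom : pdom (pmeet W Z) = Set.univ := by
      rw [pmeet_eq hWd, pdom_mkPart (equivOn_eqvGen _)]
    refine ⟨isPartition_pmeet hWd, hdom, ?_⟩
    rw [infinite_iff (isPartition_pmeet hWd) hdom]
    intro n
    obtain ⟨m, hm, hmin⟩ := hM.exists_isBlockMin (max n N)
    refine ⟨m, le_trans (le_max_left _ _) hm, fun b hb hbm => ?_⟩
    have hNm : N ≤ m := le_trans (le_max_right _ _) hm
    have hZr : ∀ a b, sameBlock Z a b →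
        sameBlock M a b ∨ ((∃ x < N, sameBlock M a x) ∧ ∃ x < N, sameBlock M b x) := by
      intro a b hab
      rcases h a b hab with h | ⟨⟨x, hx, hax⟩, y, hy, hby⟩
      · exact Or.inl (sameBlock_pmeet_right hWd h)
      · exact Or.inr ⟨⟨x, hx, sameBlock_pmeet_right hWd hax⟩, y, hy,
          sameBlock_pmeet_right hWd hby⟩
    rcases pmeet_le hr hWd (fun a b h => Or.inl (sameBlock_pmeet_left hWd h)) hZr hbm with
      h | ⟨-, x, hx, hmx⟩
    · exact hmin b hb h
    · exact hmin x (by omega) hmx.symm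
  set G : Set (Set (Set ℕ)) :=
    {V | InfPart V ∧ ∃ W ∈ F, ∀ a b, sameBlock V a b → sameBlock (pmeet W Z) a b} with hGdef
  have hmeet : ∀ V ∈ G, ∀ V' ∈ G, pmeet V V' ∈ G := by
    rintro V ⟨hV, W, hW, hWV⟩ V' ⟨hV', W', hW', hWV'⟩
    have hWd := (hf.mem_infPart W hW).2.1
    have hWd' := (hf.mem_infPart W' hW').2.1
    have hWW := hf.meet_mem W hW W' hW'
    have hWWd := (hf.mem_infPart _ hWW).2.1
    have hle : ∀ a b, sameBlock (pmeet V V') a b → sameBlock (pmeet (pmeet W W') Z) a b := by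
      intro a b hab
      have hmono : ∀ U, (∀ a b, sameBlock U a b → sameBlock (pmeet W W') a b) →
          pdom U = Set.univ → ∀ a b, sameBlock (pmeet U Z) a b →
            sameBlock (pmeet (pmeet W W') Z) a b := by
        intro U hU hUd a b hab
        exact pmeet_le (hinf _ hWW).equivOn hUd
          (fun a b h => sameBlock_pmeet_left hWWd (hU a b h))
          (fun a b h => sameBlock_pmeet_right hWWd h) hab
      exact pmeet_le (hinf _ hWW).equivOn hV.2.1
        (fun a b h => hmono W (fun a b h => sameBlock_pmeet_left hWd h) hWd a b (hWV a b h))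
        (fun a b h => hmono W' (fun a b h => sameBlock_pmeet_right hWd h) hWd' a b
          (hWV' a b h)) hab
    refine ⟨infPart_of_finer (hinf _ hWW) (isPartition_pmeet hV.2.1) ?_ hle, _, hWW, hle⟩
    rw [pmeet_eq hV.2.1, pdom_mkPart (equivOn_eqvGen _)]
  have hG : IsPFilter G := by
    refine ⟨fun V hV => hV.1, fun h => h.1.2.2 Set.finite_empty, ?_,
      fun V hV V' hV' => (hmeet V hV V' hV').1, hmeet⟩
    rintro V ⟨hV, W, hW, hWV⟩ V' hV' hVV'
    exact ⟨hV', W, hW, fun a b h => hWV a b ((hV.coarser_iff hV'.1).1 hVV' a b h)⟩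
  have hFG : F ⊆ G := fun V hV =>
    ⟨hf.mem_infPart V hV, V, hV, fun a b h =>
      sameBlock_pmeet_left (hf.mem_infPart V hV).2.1 h⟩
  rw [hmax G hG hFG]
  exact ⟨hZ, Y, hY, fun a b h => sameBlock_pmeet_right (hf.mem_infPart Y hY).2.1 h⟩

/-- Members of an ultrafilter can be coarsened to realise a given finite coarser segment. -/
lemma exists_mem_ellNbhd (hF : IsPUltrafilter F) (hY : Y ∈ F) (hu : FinPart u)
    (h : Coarser u Y) : ∃ Z ∈ F, Z ∈ EllNbhd u Y := by
  have hYi := hF.1.mem_infPart Y hY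
  rw [hu.coarser_iff hYi.1] at h
  set r : ℕ → ℕ → Prop := fun a b =>
    sameBlock Y a b ∨ ∃ x y, sameBlock Y a x ∧ sameBlock Y b y ∧ sameBlock u x y with hrdef
  have hr : EquivOn Set.univ r := by
    refine ⟨fun a _ => Or.inl (hYi.refl a), ?_, ?_⟩
    · rintro a b (h | ⟨x, y, h₁, h₂, h₃⟩)
      · exact Or.inl h.symm
      · exact Or.inr ⟨y, x, h₂, h₁, h₃.symm⟩
    · rintro a b c (k | ⟨x, y, h₁, h₂, h₃⟩) (k' | ⟨x', y', h₁', h₂', h₃'⟩)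
      · exact Or.inl (hYi.1.trans k k')
      · exact Or.inr ⟨x', y', hYi.1.trans k h₁', h₂', h₃'⟩
      · exact Or.inr ⟨x, y, h₁, hYi.1.trans k'.symm h₂, h₃⟩
      · exact Or.inr ⟨x, y', h₁, h₂', hu.1.trans h₃ (hu.1.trans
          (h y (hu.lt h₃).2 x' (hu.lt h₃').1 (hYi.1.trans h₂.symm h₁')) h₃')⟩
  have hZi : InfPart (mkPart Set.univ r) := by
    refine infPart_mkPart hr fun n => ?_
    obtain ⟨m, hm, hmin⟩ := hYi.exists_isBlockMin (max n (finBound u))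
    refine ⟨m, le_trans (le_max_left _ _) hm, ?_⟩
    rintro b hb (h | ⟨x, y, -, h₂, h₃⟩)
    · exact hmin b hb h
    · exact hmin y (lt_of_lt_of_le (hu.lt h₃).2 (le_trans (le_max_right _ _) hm)) h₂.symm
  refine ⟨mkPart Set.univ r, ?_, hZi, ?_, ?_⟩
  · refine mem_of_finite_gluing (N := finBound u) hF hY hZi fun a b hab => ?_
    rw [sameBlock_mkPart_univ hr] at hab
    rcases hab with h | ⟨x, y, h₁, h₂, h₃⟩
    · exact Or.inl h
    · exact Or.inr ⟨⟨x, (hu.lt h₃).1, h₁⟩, y, (hu.lt h₃).2, h₂⟩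
  · rw [hZi.segment_iff hu]
    intro a ha b hb
    rw [sameBlock_mkPart_univ hr]
    constructor
    · exact fun hab => Or.inr ⟨a, b, hYi.refl a, hYi.refl b, hab⟩
    · rintro (h' | ⟨x, y, h₁, h₂, h₃⟩)
      · exact h a ha b hb h'
      · exact hu.1.trans (h a ha x (hu.lt h₃).1 h₁)
          (hu.1.trans h₃ (h y (hu.lt h₃).2 b hb h₂.symm))
  · rw [hZi.coarser_iff hYi.1]
    intro a b hab
    rw [sameBlock_mkPart_univ hr]
    exact Or.inl hab

/-- The least element of the block of `a`. -/
noncomputable def blockMin (X : Set (Set ℕ)) (a : ℕ) : ℕ := sInf {x | sameBlock X a x}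

lemma InfPart.sameBlock_blockMin (hX : InfPart X) (a : ℕ) : sameBlock X a (blockMin X a) :=
  Nat.sInf_mem (s := {x | sameBlock X a x}) ⟨a, hX.refl a⟩

lemma blockMin_le (h : sameBlock X a b) : blockMin X a ≤ b := Nat.sInf_le h

lemma InfPart.blockMin_eq (hX : InfPart X) (h : sameBlock X a b) :
    blockMin X a = blockMin X b := by
  have : {x | sameBlock X a x} = {x | sameBlock X b x} := by
    ext x
    exact ⟨fun k => hX.1.trans h.symm k, fun k => hX.1.trans h k⟩
  rw [blockMin, blockMin, this]

lemma InfPart.blockMin_le_self (hX : InfPart X) (a : ℕ) : blockMin X a ≤ a :=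
  blockMin_le (hX.refl a)

lemma InfPart.isBlockMin_blockMin (hX : InfPart X) (a : ℕ) : IsBlockMin X (blockMin X a) := by
  intro b hb h
  have := blockMin_le (hX.1.trans (hX.sameBlock_blockMin a) h.symm)
  omega

lemma IsBlockMin.blockMin_eq (h : IsBlockMin X a) (hX : InfPart X) : blockMin X a = a := by
  by_contra hne
  exact h _ (lt_of_le_of_ne (hX.blockMin_le_self a) hne) (hX.sameBlock_blockMin a).symm

/-- Amalgamation: a member of `F` below `(u*, Y)`, where `u` coarsens `t` on the same domain, is
induced by a member of `F` below `(t*, Y)`. -/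
lemma exists_amalgamation (hF : IsPUltrafilter F) (ht : FinPart t) (hu : FinPart u)
    (hd : finBound u = finBound t) (hY : Y ∈ F) (htY : Segment (sStar t) Y)
    (hZ : Z ∈ F) (hZY : Z ∈ EllNbhd (sStar u) Y) :
    ∃ W ∈ F, W ∈ EllNbhd (sStar t) Y ∧ ∀ P, IsPartition P → IsLowerSet (pdom P) →
      Segment u P → Coarser P W → Coarser P Z := by
  classical
  have hYi := hF.1.mem_infPart Y hY
  obtain ⟨hZi, huZ, hZY⟩ := hZY
  rw [hZi.coarser_iff hYi.1] at hZY
  set N := finBound t with hN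
  set g : ℕ → ℕ := fun a => if ∃ x < N, sameBlock Y a x then blockMin Y a else blockMin Z a
    with hg
  have hr : EquivOn Set.univ fun a b => g a = g b :=
    ⟨fun _ _ => rfl, fun _ _ h => h.symm, fun _ _ _ h h' => h.trans h'⟩
  have hgZ : ∀ a, sameBlock Z a (g a) := by
    intro a
    simp only [hg]
    split_ifs
    · exact hZY _ _ (hYi.sameBlock_blockMin a)
    · exact hZi.sameBlock_blockMin a
  have hgY : ∀ a b, sameBlock Y a b → g a = g b := by
    intro a b hab
    have hiff : (∃ x < N, sameBlock Y a x) ↔ ∃ x < N, sameBlock Y b x :=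
      ⟨fun ⟨x, hx, h⟩ => ⟨x, hx, hYi.1.trans hab.symm h⟩,
        fun ⟨x, hx, h⟩ => ⟨x, hx, hYi.1.trans hab h⟩⟩
    simp only [hg, hiff, hYi.blockMin_eq hab, hZi.blockMin_eq (hZY _ _ hab)]
  have hgle : ∀ a, g a ≤ a := by
    intro a
    simp only [hg]
    split_ifs
    · exact hYi.blockMin_le_self a
    · exact hZi.blockMin_le_self a
  have hNZ : IsBlockMin Z N := by
    intro b hb h
    have := (huZ.iff hu.sStar hZi.1 (by rw [finBound_sStar hu]; omega)
      (by rw [finBound_sStar hu]; omega)).2 h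
    rw [sameBlock_sStar] at this
    rcases this with h | h
    · have := hu.lt h
      omega
    · omega
  have hbig : ∀ a, N ≤ g a → g a = blockMin Z a ∧ ∀ x < N, ¬ sameBlock Z a x := by
    intro a ha
    by_cases h : ∃ x < N, sameBlock Y a x
    · simp only [hg, if_pos h] at ha
      obtain ⟨x, hx, hax⟩ := h
      have := blockMin_le hax
      omega
    · simp only [hg, if_neg h] at ha ⊢
      refine ⟨trivial, fun x hx hax => ?_⟩
      have := blockMin_le hax
      omega
  have hgsmall : ∀ a < N, g a = blockMin Y a := fun a ha => by
    simp only [hg, if_pos (⟨a, ha, hYi.refl a⟩ : ∃ x < N, sameBlock Y a x)]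
  have hgfix : ∀ m, IsBlockMin Z m → g m = m := by
    intro m hm
    have hmY : IsBlockMin Y m := fun b hb h => hm b hb (hZY _ _ h)
    simp only [hg]
    split_ifs
    · exact hmY.blockMin_eq hYi
    · exact hm.blockMin_eq hZi
  have hgg : ∀ a, g (g a) = g a := by
    intro a
    by_cases h : ∃ x < N, sameBlock Y a x
    · have : g a = blockMin Y a := by simp only [hg, if_pos h]
      rw [this, ← hgY _ _ (hYi.sameBlock_blockMin a), this]
    · have : g a = blockMin Z a := by simp only [hg, if_neg h]
      rw [this]
      exact hgfix _ (hZi.isBlockMin_blockMin a)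
  have hWi : InfPart (mkPart Set.univ fun a b => g a = g b) := by
    refine infPart_mkPart hr fun n => ?_
    obtain ⟨m, hm, hmin⟩ := hZi.exists_isBlockMin n
    refine ⟨m, hm, fun b hb h => hmin b hb ?_⟩
    have := hgZ b
    rwa [h, hgfix m hmin] at this
  refine ⟨mkPart Set.univ fun a b => g a = g b, ?_, ⟨hWi, ?_, ?_⟩, ?_⟩
  · refine hF.1.upward Z hZ _ hWi ?_
    rw [hZi.coarser_iff hWi.1]
    intro a b hab
    rw [sameBlock_mkPart_univ hr] at hab
    exact hZi.1.trans (hgZ a) (hab ▸ (hgZ b).symm)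
  · rw [hWi.segment_iff ht.sStar, finBound_sStar ht]
    intro a ha b hb
    rw [htY.iff ht.sStar hYi.1 (by rw [finBound_sStar ht]; exact ha)
      (by rw [finBound_sStar ht]; exact hb), sameBlock_mkPart_univ hr]
    refine ⟨hgY a b, fun hab => ?_⟩
    rcases Nat.lt_succ_iff_lt_or_eq.1 ha with ha' | ha' <;>
    rcases Nat.lt_succ_iff_lt_or_eq.1 hb with hb' | hb'
    · rw [hgsmall a ha', hgsmall b hb'] at hab
      exact hYi.1.trans (hYi.sameBlock_blockMin a) (hab ▸ (hYi.sameBlock_blockMin b).symm)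
    · rw [hb', ← hN, hgfix N hNZ] at hab
      have := hgle a
      omega
    · rw [ha', ← hN, hgfix N hNZ] at hab
      have := hgle b
      omega
    · rw [ha', hb']
      exact hYi.refl _
  · rw [hWi.coarser_iff hYi.1]
    intro a b hab
    rw [sameBlock_mkPart_univ hr]
    exact hgY a b hab
  · intro P hP hlow huP hPW
    rw [coarser_iff hP hWi.1] at hPW
    rw [coarser_iff hP hZi.1]
    intro a ha b hb hab
    have hstep : ∀ c ∈ pdom P, sameBlock P c (g c) := fun c hc =>
      hPW c hc (g c) (hlow (hgle c) hc) ((sameBlock_mkPart_univ hr).2 (hgg c).symm)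
    refine hP.trans (hstep a ha) (hP.trans ?_ (hstep b hb).symm)
    have hgab : sameBlock Z (g a) (g b) := hZi.1.trans (hgZ a).symm (hZi.1.trans hab (hgZ b))
    rcases lt_or_ge (g a) N with h₁ | h₁ <;> rcases lt_or_ge (g b) N with h₂ | h₂
    · refine huP.mono hu hP ?_
      have huZ' := (segment_sStar hu).trans huZ hu hu.sStar hZi.1
      exact (huZ'.iff hu hZi.1 (by omega) (by omega)).2 hgab
    · exact absurd (hZi.1.trans hab.symm (hgZ a)) ((hbig b h₂).2 _ h₁)
    · exact absurd (hZi.1.trans hab (hgZ b)) ((hbig a h₁).2 _ h₂)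
    · rw [(hbig a h₁).1, (hbig b h₂).1, hZi.blockMin_eq hab, ← (hbig b h₂).1]
      exact sameBlock_refl (hlow (hgle b) hb)

end Filters

section Segments

variable {P Q R s t u v w X Y Z : Set (Set ℕ)} {a b c M N : ℕ} {F : Set (Set (Set ℕ))}

/-- The pullback of the partition `v` along `h`, as a partition of `{0, …, M - 1}`. -/
def fill (v : Set (Set ℕ)) (h : ℕ → ℕ) (M : ℕ) : Set (Set ℕ) :=
  mkPart (Set.Iio M) fun a b => sameBlock v (h a) (h b)

section fill

variable {h : ℕ → ℕ}

lemma equivOn_fill (hv : FinPart v) (hh : ∀ a < M, h a < finBound v) :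
    EquivOn (Set.Iio M) fun a b => sameBlock v (h a) (h b) :=
  ⟨fun a ha => hv.refl (hh a ha), fun _ _ h => h.symm, fun _ _ _ h h' => hv.1.trans h h'⟩

lemma finPart_fill (hv : FinPart v) (hh : ∀ a < M, h a < finBound v) : FinPart (fill v h M) :=
  finPart_mkPart (equivOn_fill hv hh)

lemma finBound_fill (hv : FinPart v) (hh : ∀ a < M, h a < finBound v) :
    finBound (fill v h M) = M :=
  finBound_mkPart (equivOn_fill hv hh)

lemma sameBlock_fill (hv : FinPart v) (hh : ∀ a < M, h a < finBound v) :
    sameBlock (fill v h M) a b ↔ a < M ∧ b < M ∧ sameBlock v (h a) (h b) :=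
  sameBlock_mkPart (equivOn_fill hv hh)

lemma ext_fill (hv : FinPart v) (hh : ∀ a < M, h a < finBound v) (hM : finBound v ≤ M)
    (hid : ∀ a < finBound v, sameBlock v a (h a)) : Ext v (fill v h M) := by
  refine ⟨hv, finPart_fill hv hh, ?_, ?_⟩
  · rw [hv.segment_iff (finPart_fill hv hh), finBound_fill hv hh]
    refine ⟨hM, fun a ha b hb => ?_⟩
    rw [sameBlock_fill hv hh]
    constructor
    · exact fun hab => ⟨by omega, by omega,
        hv.1.trans (hid a ha).symm (hv.1.trans hab (hid b hb))⟩
    · exact fun hab => hv.1.trans (hid a ha) (hv.1.trans hab.2.2 (hid b hb).symm)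
  · rw [finBound_fill hv hh]
    intro a ha
    have := hh a ha
    exact ⟨h a, this, (sameBlock_fill hv hh).2 ⟨ha, by omega, hid _ this⟩⟩

end fill

lemma sStar_coarser_iff (hu : FinPart u) (hX : InfPart X) :
    Coarser (sStar u) X ↔ IsBlockMin X (finBound u) ∧
      ∀ a < finBound u, ∀ b < finBound u, sameBlock X a b → sameBlock u a b := by
  rw [hu.sStar.coarser_iff hX.1, finBound_sStar hu]
  constructor
  · intro h
    refine ⟨fun b hb hbu => ?_, fun a ha b hb hab => ?_⟩
    · rcases sameBlock_sStar.1 (h b (by omega) _ (by omega) hbu) with h | h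
      · have := hu.lt h
        omega
      · omega
    · rcases sameBlock_sStar.1 (h a (by omega) b (by omega) hab) with h | h
      · exact h
      · omega
  · rintro ⟨hmin, h⟩ a ha b hb hab
    rw [sameBlock_sStar]
    rcases Nat.lt_succ_iff_lt_or_eq.1 ha with ha' | ha' <;>
    rcases Nat.lt_succ_iff_lt_or_eq.1 hb with hb' | hb'
    · exact Or.inl (h a ha' b hb' hab)
    · exact absurd (hb' ▸ hab) (hmin a ha')
    · exact absurd (ha' ▸ hab.symm) (hmin b hb')
    · exact Or.inr ⟨ha', hb'⟩

lemma segment_sStar_of_isBlockMin (hu : FinPart u) (hX : InfPart X) (h : Segment u X)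
    (hmin : IsBlockMin X (finBound u)) : Segment (sStar u) X := by
  rw [hX.segment_iff hu.sStar]
  intro a ha b hb
  constructor
  · intro hab
    rcases sameBlock_sStar.1 hab with h' | ⟨rfl, rfl⟩
    · exact h.mono hu hX.1 h'
    · exact hX.refl _
  · exact (hu.sStar.coarser_iff hX.1).1
      ((sStar_coarser_iff hu hX).2 ⟨hmin, fun a ha b hb => (h.iff hu hX.1 ha hb).2⟩) a ha b hb

lemma isBlockMin_of_segment_sStar (hu : FinPart u) (hX : InfPart X) (h : Segment (sStar u) X) :
    IsBlockMin X (finBound u) :=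
  ((sStar_coarser_iff hu hX).1 (h.coarser hu.sStar hX.1)).1

lemma segment_of_sStar (hu : FinPart u) (hX : IsPartition X) (h : Segment (sStar u) X) :
    Segment u X :=
  (segment_sStar hu).trans h hu hu.sStar hX

lemma equivOn_restrict (hP : IsPartition P) (hN : Set.Iio N ⊆ pdom P) :
    EquivOn (Set.Iio N) (sameBlock P) :=
  ⟨fun _ ha => sameBlock_refl (hN ha), fun _ _ h => h.symm, fun _ _ _ h h' => hP.trans h h'⟩

/-- An initial segment of an infinite partition can be prolonged up to the next new block. -/
lemma exists_ext_segment (hX : InfPart X) (ht : FinPart t) (h : Segment t X) :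
    ∃ u, Ext t u ∧ Segment (sStar u) X := by
  classical
  have hex : ∃ m, finBound t ≤ m ∧ IsBlockMin X m := hX.exists_isBlockMin _
  set m := Nat.find hex with hm
  obtain ⟨htm, hmin⟩ := Nat.find_spec hex
  rw [← hm] at htm hmin
  have hr := equivOn_restrict (N := m) hX.1 (by rw [hX.2.1]; exact Set.subset_univ _)
  have hu := finPart_mkPart hr
  have huX : Segment (mkPart (Set.Iio m) (sameBlock X)) X := by
    rw [hX.segment_iff hu, finBound_mkPart hr]
    intro a ha b hb
    rw [sameBlock_mkPart hr]
    exact ⟨fun h => h.2.2, fun h => ⟨ha, hb, h⟩⟩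
  refine ⟨mkPart (Set.Iio m) (sameBlock X), ⟨ht, hu, ?_, ?_⟩, ?_⟩
  · rw [ht.segment_iff hu, finBound_mkPart hr]
    refine ⟨htm, fun a ha b hb => ?_⟩
    rw [h.iff ht hX.1 ha hb, huX.iff hu hX.1] <;> rw [finBound_mkPart hr] <;> omega
  · rw [finBound_mkPart hr]
    intro a ha
    refine ⟨blockMin X a, ?_, (sameBlock_mkPart hr).2
      ⟨ha, lt_of_le_of_lt (hX.blockMin_le_self a) ha, hX.sameBlock_blockMin a⟩⟩
    by_contra hlt
    have := Nat.find_min' hex ⟨not_lt.1 hlt, hX.isBlockMin_blockMin a⟩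
    have := hX.blockMin_le_self a
    omega
  · refine segment_sStar_of_isBlockMin hu hX huX ?_
    rwa [finBound_mkPart hr]

/-- A segment with more blocks than `s` passes through a prolongation of `s` without new
blocks. -/
lemma exists_ext_of_ncard_lt (hs : FinPart s) (hw : FinPart w) (hsw : Segment s w)
    (hc : s.ncard < w.ncard) : ∃ u, Ext s u ∧ Segment (sStar u) w := by
  classical
  have hex : ∃ a, a < finBound w ∧ ∀ b < finBound s, ¬ sameBlock w a b := by
    by_contra! h
    exact hc.ne' ((ncard_eq_iff hs hw hsw).2 h)
  set m := Nat.find hex with hm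
  obtain ⟨hmw, hmin⟩ := Nat.find_spec hex
  rw [← hm] at hmw hmin
  have hold : ∀ a < m, ∃ b < finBound s, sameBlock w a b := by
    intro a ha
    have := Nat.find_min hex ha
    push Not at this
    exact this (by omega)
  have hsm : finBound s ≤ m := by
    by_contra hlt
    exact hmin m (not_le.1 hlt) (hw.refl hmw)
  have hr := equivOn_restrict (N := m) hw.1 (by
    rw [hw.pdom_eq]; exact Set.Iio_subset_Iio hmw.le)
  have hu := finPart_mkPart hr
  refine ⟨mkPart (Set.Iio m) (sameBlock w), ⟨hs, hu, ?_, ?_⟩, ?_⟩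
  · rw [hs.segment_iff hu, finBound_mkPart hr]
    refine ⟨hsm, fun a ha b hb => ?_⟩
    rw [hsw.iff hs hw.1 ha hb, sameBlock_mkPart hr]
    exact ⟨fun h => ⟨lt_of_lt_of_le ha hsm, lt_of_lt_of_le hb hsm, h⟩, fun h => h.2.2⟩
  · rw [finBound_mkPart hr]
    intro a ha
    obtain ⟨b, hb, hab⟩ := hold a ha
    exact ⟨b, hb, (sameBlock_mkPart hr).2 ⟨ha, lt_of_lt_of_le hb hsm, hab⟩⟩
  · rw [hu.sStar.segment_iff hw, finBound_sStar hu, finBound_mkPart hr]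
    refine ⟨hmw, fun a ha b hb => ?_⟩
    rw [sameBlock_sStar, finBound_mkPart hr, sameBlock_mkPart hr]
    have hnew : ∀ c < m, ¬ sameBlock w c m := by
      intro c hc hcm
      obtain ⟨d, hd, hcd⟩ := hold c hc
      exact hmin d hd (hw.1.trans hcm.symm hcd)
    constructor
    · rintro (h | ⟨rfl, rfl⟩)
      · exact h.2.2
      · exact hw.refl hmw
    · intro hab
      rcases Nat.lt_succ_iff_lt_or_eq.1 ha with ha' | ha' <;>
      rcases Nat.lt_succ_iff_lt_or_eq.1 hb with hb' | hb'
      · exact Or.inl ⟨ha', hb', hab⟩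
      · exact absurd (hb' ▸ hab) (hnew a ha')
      · exact absurd (ha' ▸ hab.symm) (hnew b hb')
      · exact Or.inr ⟨ha', hb'⟩

/-- If `u* ⪯ w` and `w* ⊑ X`, then `u* ⊑ X`. -/
lemma sStar_coarser_of_segment (hu : FinPart u) (hw : FinPart w) (hX : InfPart X)
    (huw : Segment (sStar u) w) (hwX : Coarser (sStar w) X) : Coarser (sStar u) X := by
  have hle := huw.le hu.sStar hw
  rw [hu.sStar.coarser_iff hX.1]
  intro a ha b hb hab
  exact (huw.iff hu.sStar hw.1 ha hb).2
    (((sStar_coarser_iff hw hX).1 hwX).2 a (by omega) b (by omega) hab)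

/-- If player I has no winning strategy, then every recipe for prolonging positions of the game
admits a run whose outcome is in the filter. -/
lemma exists_outcome (hF : GameFilter F) (hs : FinPart s) (hX : X ∈ F)
    (Φ : Set (Set ℕ) → Set (Set ℕ) → Prop)
    (h0 : ∃ t Y, Ext s t ∧ Y ∈ F ∧ Y ∈ EllNbhd (sStar t) X ∧ Φ t Y)
    (hstep : ∀ t Y, FinPart t → Segment s t → Y ∈ F → Coarser Y X → Φ t Y →
      ∀ X' ∈ F, X' ∈ EllNbhd (sStar t) Y →
        ∃ u Z, Ext (sStar t) u ∧ Z ∈ F ∧ Z ∈ EllNbhd (sStar u) X' ∧ Φ u Z) :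
    ∃ Z ∈ F, Z ∈ EllNbhd s X ∧ ∀ u ∈ nseg s Z s.ncard,
      ∃ t Y, FinPart t ∧ Φ t Y ∧ u ∈ iseg0 s t ∧ Coarser Z Y := by
  classical
  have hinf := hF.1.1.mem_infPart
  obtain ⟨t₀, Y₀, ht₀, hY₀, hY₀X, hΦ₀⟩ := h0
  have hnext : ∀ q : MoveI, ∀ X', ∃ q' : MoveI,
      (FinPart q.1 → Segment s q.1 → q.2 ∈ F → Coarser q.2 X → Φ q.1 q.2 → X' ∈ F →
        X' ∈ EllNbhd (sStar q.1) q.2 →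
        Ext (sStar q.1) q'.1 ∧ q'.2 ∈ F ∧ q'.2 ∈ EllNbhd (sStar q'.1) X' ∧ Φ q'.1 q'.2) := by
    intro q X'
    by_cases h : FinPart q.1 ∧ Segment s q.1 ∧ q.2 ∈ F ∧ Coarser q.2 X ∧ Φ q.1 q.2 ∧ X' ∈ F ∧
        X' ∈ EllNbhd (sStar q.1) q.2
    · obtain ⟨h₁, h₂, h₃, h₄, h₅, h₆, h₇⟩ := h
      obtain ⟨u, Z, hu⟩ := hstep q.1 q.2 h₁ h₂ h₃ h₄ h₅ X' h₆ h₇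
      exact ⟨(u, Z), fun _ _ _ _ _ _ _ => hu⟩
    · exact ⟨q, fun h₁ h₂ h₃ h₄ h₅ h₆ h₇ => absurd ⟨h₁, h₂, h₃, h₄, h₅, h₆, h₇⟩ h⟩
  choose next hnext using hnext
  have hno := hF.2 fun L => L.foldl next (t₀, Y₀)
  unfold WinningStratI at hno
  push Not at hno
  obtain ⟨t, Y, X', hfol, hlose⟩ := hno
  have hzero : (t 0, Y 0) = (t₀, Y₀) := by simpa using (hfol 0).symm
  have hsucc : ∀ n, (t (n + 1), Y (n + 1)) = next (t n, Y n) (X' n) := by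
    intro n
    rw [← hfol (n + 1), ← hfol n, List.ofFn_succ']
    simp
  have hinv : ∀ n, (∀ m < n, LegalII F t Y X' m) →
      FinPart (t n) ∧ Segment s (t n) ∧ Y n ∈ F ∧ Coarser (Y n) X ∧ Φ (t n) (Y n) ∧
      Segment (sStar (t n)) (Y n) ∧
      ∀ m, n = m + 1 → Ext (sStar (t m)) (t n) ∧ Coarser (Y n) (X' m) := by
    intro n
    induction n with
    | zero =>
      intro _
      obtain ⟨h₁, h₂⟩ := Prod.mk.inj hzero
      rw [h₁, h₂]
      exact ⟨ht₀.fin, ht₀.seg, hY₀, hY₀X.2.2, hΦ₀, hY₀X.2.1, fun m hm => by omega⟩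
    | succ n ih =>
      intro hleg
      obtain ⟨h₁, h₂, h₃, h₄, h₅, h₆, -⟩ := ih fun m hm => hleg m (by omega)
      obtain ⟨hX'F, hX'⟩ := hleg n (by omega)
      have hn := hnext (t n, Y n) (X' n) h₁ h₂ h₃ h₄ h₅ hX'F hX'
      rw [← hsucc n] at hn
      obtain ⟨k₁, k₂, k₃, k₄⟩ := hn
      refine ⟨k₁.fin, ?_, k₂, ?_, k₄, k₃.2.1, ?_⟩
      · exact (h₂.trans (segment_sStar h₁) (‹FinPart s›) h₁ h₁.sStar.1).trans k₁.seg hs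
          h₁.sStar k₁.fin.1
      · exact (k₃.2.2.trans hX'.2.2 k₃.1.1 hX'.1 (hinf _ h₃).1).trans h₄ k₃.1.1 (hinf _ h₃)
          (hinf _ hX).1
      · intro m hm
        obtain rfl : n = m := by omega
        exact ⟨k₁, k₃.2.2⟩
  obtain ⟨hleg, Z, hZi, htZ, hZF⟩ := hlose (by
    intro n hn
    obtain ⟨h₁, h₂, h₃, h₄, h₅, h₆, h₇⟩ := hinv n hn
    refine ⟨h₁, h₃, ⟨Y n, hinf _ h₃, h₆, (hinf _ h₃).coarser_refl⟩, ?_⟩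
    intro m hm
    obtain ⟨k₁, k₂⟩ := h₇ m hm
    obtain ⟨g₁, -⟩ := hinv m fun j hj => hn j (by omega)
    have hX'm := hinf _ (hn m (by omega)).1
    refine ⟨k₁.seg.trans (segment_sStar h₁) g₁.sStar h₁ h₁.sStar.1, ?_, ?_⟩
    · exact (h₆.coarser h₁.sStar (hinf _ h₃).1).trans k₂ h₁.sStar.1 (hinf _ h₃) hX'm.1
    · rw [k₁.ncard, ncard_sStar g₁])
  replace hinv := fun n => hinv n fun m _ => hleg m
  have hfin : ∀ n, FinPart (t n) := fun n => (hinv n).1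
  have hext : ∀ n, Ext (sStar (t n)) (t (n + 1)) := fun n => ((hinv (n + 1)).2.2.2.2.2.2 n rfl).1
  have hlt : ∀ n, finBound (t n) < finBound (t (n + 1)) := by
    intro n
    have := (hext n).seg.le (hfin n).sStar (hfin (n + 1))
    rwa [finBound_sStar (hfin n)] at this
  have hmono : StrictMono fun n => finBound (t n) := strictMono_nat_of_lt_succ hlt
  have hYle : ∀ n k a b, sameBlock (Y n) a b → sameBlock (Y (n + k)) a b := by
    intro n k
    induction k with
    | zero => exact fun a b h => h
    | succ k ih =>
      intro a b h
      have hX' := (hleg (n + k)).2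
      have h₁ := (hX'.1.coarser_iff (hinf _ (hinv (n + k)).2.2.1).1).1 hX'.2.2 a b (ih a b h)
      exact ((hinf _ (hinv (n + k + 1)).2.2.1).coarser_iff hX'.1.1).1
        ((hinv (n + k + 1)).2.2.2.2.2.2 _ rfl).2 a b h₁
  have hZY : ∀ n a b, sameBlock (Y n) a b → sameBlock Z a b := by
    intro n a b hab
    set k := n + (a + b + 1) with hk
    have hk' : k ≤ finBound (t k) := hmono.le_apply
    have h₁ := hYle n (a + b + 1) a b hab
    rw [← hk] at h₁
    have hseg := segment_of_sStar (hfin k) (hinf _ (hinv k).2.2.1).1 (hinv k).2.2.2.2.2.1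
    exact (htZ k).mono (hfin k) hZi.1
      ((hseg.iff (hfin k) (hinf _ (hinv k).2.2.1).1 (by omega) (by omega)).2 h₁)
  have hZYn : ∀ n, Coarser Z (Y n) := fun n =>
    (hZi.coarser_iff (hinf _ (hinv n).2.2.1).1).2 (hZY n)
  refine ⟨Z, hZF, ⟨hZi, (hinv 0).2.1.trans (htZ 0) hs (hfin 0) hZi.1, ?_⟩, ?_⟩
  · exact (hZYn 0).trans (hinv 0).2.2.2.1 hZi.1 (hinf _ (hinv 0).2.2.1) (hinf _ hX).1
  · intro u hu
    rw [mem_nseg_iff hs] at hu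
    obtain ⟨hue, huZ⟩ := hu
    obtain ⟨hmin, huZ⟩ := (sStar_coarser_iff hue.fin hZi).1 huZ
    have hsu := hue.seg.le hs hue.fin
    have hnmin : ∀ n b, b < finBound u → sameBlock (t n) (finBound u) b → False :=
      fun n b hb h => hmin b hb ((htZ n).mono (hfin n) hZi.1 h.symm)
    have hex : ∃ n, finBound u < finBound (t n) :=
      ⟨finBound u + 1, lt_of_lt_of_le (Nat.lt_succ_self _) hmono.le_apply⟩
    have hidx : ∃ n, finBound u = finBound (t n) := by
      obtain ⟨n, hn, hleast⟩ : ∃ n, finBound u < finBound (t n) ∧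
          ∀ m < n, ¬ finBound u < finBound (t m) :=
        ⟨Nat.find hex, Nat.find_spec hex, fun m hm => Nat.find_min hex hm⟩
      cases n with
      | zero =>
        have h₁ := (Prod.mk.inj hzero).1
        rw [h₁] at hn
        obtain ⟨b, hb, h⟩ := ht₀.old _ hn
        exact (hnmin 0 b (by omega) (h₁ ▸ h)).elim
      | succ n =>
        refine ⟨n, ?_⟩
        have hle := hleast n (by omega)
        obtain ⟨b, hb, h⟩ := (hext n).old _ hn
        rw [finBound_sStar (hfin n)] at hb
        by_contra hne
        exact hnmin (n + 1) b (by omega) h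
    obtain ⟨n, hn⟩ := hidx
    refine ⟨t n, Y n, hfin n, (hinv n).2.2.2.2.1, ?_, hZYn n⟩
    rw [mem_iseg0_iff hs (hfin n)]
    refine ⟨hue, hn, fun a b hab => ?_⟩
    have := (hfin n).lt hab
    exact huZ a (by omega) b (by omega) ((htZ n).mono (hfin n) hZi.1 hab)

end Segments

section Fusion

variable {P Q R s t u v w X Y Z : Set (Set ℕ)} {a b c M N : ℕ} {F K : Set (Set (Set ℕ))}

/-- The segments `w` prolonging `q` with `w* ⊑ Y`. -/
def segs (q Y : Set (Set ℕ)) : Set (Set (Set ℕ)) :=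
  {w | FinPart w ∧ Segment q w ∧ Coarser (sStar w) Y}

lemma segs_mono (hZ : InfPart Z) (hY : InfPart Y) (h : Coarser Z Y) : segs P Z ⊆ segs P Y :=
  fun _ hw => ⟨hw.1, hw.2.1, hw.2.2.trans h hw.1.sStar.1 hZ hY.1⟩

lemma ellNbhd_trans (hX : InfPart X) (hYX : Coarser Y X) (hY : InfPart Y) (h : Z ∈ EllNbhd s Y) :
    Z ∈ EllNbhd s X :=
  ⟨h.1, h.2.1, h.2.2.trans hYX h.1.1 hY hX.1⟩

lemma coarser_of_mem_iseg0 (hs : FinPart s) (ht : FinPart t) (hY : InfPart Y)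
    (htY : Segment (sStar t) Y) (hu : u ∈ iseg0 s t) : Coarser (sStar u) Y := by
  rw [mem_iseg0_iff hs ht] at hu
  obtain ⟨hu, hd, h⟩ := hu
  rw [sStar_coarser_iff hu.fin hY, hd]
  exact ⟨isBlockMin_of_segment_sStar ht hY htY, fun a ha b hb hab => h a b
    (((segment_of_sStar ht hY.1 htY).iff ht hY.1 ha hb).2 hab)⟩

variable {Good : Set (Set ℕ) → Set (Set (Set ℕ)) → Prop}

lemma exists_good_of_iseg0 (hF : IsPUltrafilter F) (hs : FinPart s) (hX : X ∈ F)
    (hanti : ∀ u A B, B ⊆ A → Good u A → Good u B)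
    (hgood : ∀ u, Ext s u → ∀ Y ∈ F, Y ∈ EllNbhd (sStar u) X →
      ∃ Y' ∈ F, Y' ∈ EllNbhd (sStar u) Y ∧ Good u (segs (sStar u) Y'))
    (ht : FinPart t) (hY : Y ∈ F) (hYX : Coarser Y X) (htY : Segment (sStar t) Y) :
    ∃ Z ∈ F, Z ∈ EllNbhd (sStar t) Y ∧ ∀ u ∈ iseg0 s t, Good u (segs (sStar u) Z) := by
  have hinf := hF.1.mem_infPart
  suffices h : ∀ U ⊆ iseg0 s t, ∃ Z ∈ F, Z ∈ EllNbhd (sStar t) Y ∧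
      ∀ u ∈ U, Good u (segs (sStar u) Z) from h _ subset_rfl
  intro U hU
  have hUf := (finite_iseg0 ht).subset hU
  induction U, hUf using Set.Finite.induction_on with
  | empty => exact ⟨Y, hY, ⟨hinf Y hY, htY, (hinf Y hY).coarser_refl⟩, by simp⟩
  | @insert u U _ _ ih =>
    obtain ⟨Z, hZ, hZY, hZg⟩ := ih ((Set.subset_insert _ _).trans hU)
    have hu := hU (Set.mem_insert u U)
    have huZ := coarser_of_mem_iseg0 hs ht hZY.1 hZY.2.1 hu
    rw [mem_iseg0_iff hs ht] at hu
    obtain ⟨Z₁, hZ₁, hZ₁Z⟩ := exists_mem_ellNbhd hF hZ hu.1.fin.sStar huZ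
    obtain ⟨Z₂, hZ₂, hZ₂Z₁, hg⟩ := hgood u hu.1 Z₁ hZ₁ (ellNbhd_trans (hinf X hX) hYX (hinf Y hY)
      (ellNbhd_trans (hinf Y hY) hZY.2.2 hZY.1 hZ₁Z))
    obtain ⟨W, hW, hWZ, hWP⟩ := exists_amalgamation hF ht hu.1.fin hu.2.1 hZ hZY.2.1 hZ₂
      (ellNbhd_trans hZY.1 hZ₁Z.2.2 hZ₁Z.1 hZ₂Z₁)
    refine ⟨W, hW, ellNbhd_trans (hinf Y hY) hZY.2.2 hZY.1 hWZ, ?_⟩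
    rintro x (rfl | hx)
    · refine hanti _ (segs (sStar x) Z₂) _ (fun w hw => ⟨hw.1, hw.2.1, ?_⟩) hg
      have hxw := (segment_sStar hu.1.fin).trans hw.2.1 hu.1.fin hu.1.fin.sStar hw.1.1
      refine hWP _ hw.1.sStar.1 ?_ (hxw.trans (segment_sStar hw.1) hu.1.fin hw.1 hw.1.sStar.1)
        hw.2.2
      rw [pdom_sStar hw.1]
      exact isLowerSet_Iio _
    · exact hanti _ _ _ (segs_mono hWZ.1 hZY.1 hWZ.2.2) (hZg x hx)

/-- Fusion: a property of segments that can be secured one segment at a time can be secured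
for all segments at once. -/
lemma exists_fusion (hF : GameFilter F) (hs : FinPart s) (hX : X ∈ F) (hsX : Coarser s X)
    (hanti : ∀ u A B, B ⊆ A → Good u A → Good u B)
    (hgood : ∀ u, Ext s u → ∀ Y ∈ F, Y ∈ EllNbhd (sStar u) X →
      ∃ Y' ∈ F, Y' ∈ EllNbhd (sStar u) Y ∧ Good u (segs (sStar u) Y')) :
    ∃ Z ∈ F, Z ∈ EllNbhd s X ∧ ∀ u ∈ nseg s Z s.ncard, Good u (segs (sStar u) Z) := by
  have hinf := hF.1.1.mem_infPart
  have hout := exists_outcome hF hs hX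
    (fun t Y => Y ∈ F ∧ ∀ u ∈ iseg0 s t, Good u (segs (sStar u) Y)) ?_ ?_
  · obtain ⟨Z, hZ, hZX, h⟩ := hout
    refine ⟨Z, hZ, hZX, fun u hu => ?_⟩
    obtain ⟨t, Y, -, ⟨hY, hg⟩, hut, hZY⟩ := h u hu
    exact hanti _ _ _ (segs_mono hZX.1 (hinf Y hY) hZY) (hg u hut)
  · obtain ⟨Y, hY, hYX⟩ := exists_mem_ellNbhd hF.1 hX hs hsX
    obtain ⟨t, hst, htY⟩ := exists_ext_segment hYX.1 hs hYX.2.1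
    obtain ⟨Z, hZ, hZY, h⟩ := exists_good_of_iseg0 hF.1 hs hX hanti hgood hst.fin hY hYX.2.2 htY
    exact ⟨t, Z, hst, hZ, ellNbhd_trans (hinf X hX) hYX.2.2 hYX.1 hZY, hZ, h⟩
  · intro t Y ht _ hY hYX _ X' hX' hX'Y
    obtain ⟨u, htu, huX'⟩ := exists_ext_segment hX'Y.1 ht.sStar hX'Y.2.1
    obtain ⟨Z, hZ, hZY, h⟩ := exists_good_of_iseg0 hF.1 hs hX hanti hgood htu.fin hX'
      (hX'Y.2.2.trans hYX hX'Y.1.1 (hinf Y hY) (hinf X hX).1) huX'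
    exact ⟨u, Z, htu, hZ, hZY, hZ, h⟩

/-- `K` meets the segments over `s`, with as many blocks as `s`, of every member of `F` in
`(s, Y)`. -/
def Dense (F K : Set (Set (Set ℕ))) (s Y : Set (Set ℕ)) : Prop :=
  ∀ Z ∈ F, Z ∈ EllNbhd s Y → ∃ u ∈ nseg s Z s.ncard, u ∈ K

/-- Below a suitable segment, a dense set meets every `iseg0 s u`. -/
lemma Dense.exists_universal (hF : GameFilter F) (hs : FinPart s) (hY : Y ∈ F)
    (hsY : Coarser s Y) (hK : Dense F K s Y) :
    ∃ t, FinPart t ∧ Segment s t ∧ ∃ X ∈ F, X ∈ EllNbhd t Y ∧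
      ∀ u ∈ nseg t X t.ncard, ∃ v ∈ iseg0 s u, v ∈ K := by
  have hinf := hF.1.1.mem_infPart
  by_contra! hcon
  have key : ∀ t, FinPart t → Segment s t → ∀ X ∈ F, X ∈ EllNbhd t Y →
      ∃ u Z, Ext t u ∧ Z ∈ F ∧ Z ∈ EllNbhd (sStar u) X ∧ ∀ v ∈ iseg0 s u, v ∉ K := by
    intro t ht hst X hX hXY
    obtain ⟨u, hu, h⟩ := hcon t ht hst X hX hXY
    rw [mem_nseg_iff ht] at hu
    obtain ⟨Z, hZ, hZX⟩ := exists_mem_ellNbhd hF.1 hX hu.1.fin.sStar hu.2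
    exact ⟨u, Z, hu.1, hZ, hZX, h⟩
  have hout := exists_outcome hF hs hY
    (fun t _ => ∀ v ∈ iseg0 s t, v ∉ K) ?_ ?_
  · obtain ⟨Z, hZ, hZX, h⟩ := hout
    obtain ⟨u, hu, huK⟩ := hK Z hZ hZX
    obtain ⟨t, _, -, ht, hut, -⟩ := h u hu
    exact ht u hut huK
  · obtain ⟨X, hX, hXY⟩ := exists_mem_ellNbhd hF.1 hY hs hsY
    obtain ⟨u, Z, hsu, hZ, hZX, h⟩ := key s hs (segment_refl hs) X hX hXY
    exact ⟨u, Z, hsu, hZ, ellNbhd_trans (hinf Y hY) hXY.2.2 hXY.1 hZX, h⟩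
  · intro t Z ht hst hZ hZY _ X' hX' hX'Z
    exact key (sStar t) ht.sStar (hst.trans (segment_sStar ht) hs ht ht.sStar.1) X' hX'
      (ellNbhd_trans (hinf Y hY) hZY (hinf Z hZ) hX'Z)

end Fusion

section Words

variable {A κ : Type} [Finite A]

/-- Iterated Hales–Jewett: words `u 0, …, u m` of bounded length such that the colours of
`u i` extended by a suitable left-variable word and of `u j` agree. -/
lemma exists_words_chain [Nonempty A] (m : ℕ) : ∀ (κ : Type) [Finite κ], ∃ M, ∀ c : List A → κ,
    ∃ u : ℕ → List A, (∀ i ≤ m, (u i).length ≤ M) ∧ ∀ i j, i < j → j ≤ m →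
      ∃ y : List (Option A), ∀ a, c (u i ++ (none :: y).map (·.getD a)) = c (u j) := by
  classical
  induction m with
  | zero => exact fun κ _ => ⟨0, fun c => ⟨fun _ => [], by simp, by omega⟩⟩
  | succ m ih =>
    intro κ _
    obtain ⟨M, hM⟩ := ih κ
    have : Finite {w : List A | w.length ≤ M} := (List.finite_length_le A M).to_subtype
    obtain ⟨ι, _, hι⟩ := Combinatorics.Line.exists_mono_in_high_dimension A
      ({w : List A | w.length ≤ M} → κ)
    let e := Fintype.equivFin ι
    let a₀ : A := Classical.arbitrary A
    refine ⟨Fintype.card ι + M, fun c => ?_⟩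
    obtain ⟨l, col, hl⟩ := hι fun x w => c (List.ofFn (x ∘ e.symm) ++ w)
    have hofFn : ∀ a, List.ofFn (l a ∘ e.symm) =
        (List.ofFn (l.idxFun ∘ e.symm)).map (·.getD a) := by
      intro a
      rw [List.map_ofFn]
      rfl
    have hmem : none ∈ List.ofFn (l.idxFun ∘ e.symm) := by
      obtain ⟨i, hi⟩ := l.proper
      rw [List.mem_ofFn]
      exact ⟨e i, by simp [hi]⟩
    obtain ⟨z, y, hzy, hz⟩ := List.eq_append_cons_of_mem hmem
    have hzmap : ∀ a, z.map (·.getD a) = z.map (·.getD a₀) := by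
      intro a
      refine List.map_congr_left fun x hx => ?_
      cases x with
      | none => exact absurd hx hz
      | some x => rfl
    have hlen : z.length ≤ Fintype.card ι := by
      have := congrArg List.length hzy
      simp only [List.length_ofFn, List.length_append, List.length_cons] at this
      omega
    have hmono : ∀ a (w : List A), w.length ≤ M →
        c (List.ofFn (l a ∘ e.symm) ++ w) = c (List.ofFn (l a₀ ∘ e.symm) ++ w) := by
      intro a w hw
      exact congrFun ((hl a).trans (hl a₀).symm) ⟨w, hw⟩
    obtain ⟨u, hu, huy⟩ := hM fun w => c (List.ofFn (l a₀ ∘ e.symm) ++ w)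
    refine ⟨fun i => i.casesOn (z.map (·.getD a₀)) fun i => List.ofFn (l a₀ ∘ e.symm) ++ u i,
      ?_, ?_⟩
    · rintro (_ | i) hi
      · change (z.map (·.getD a₀)).length ≤ _
        rw [List.length_map]
        omega
      · have := hu i (by omega)
        simp only [List.length_append, List.length_ofFn]
        omega
    · rintro i (_ | j) hij hj
      · omega
      rcases i with _ | i
      · refine ⟨y ++ (u j).map some, fun a => ?_⟩
        change c (z.map (·.getD a₀) ++ _) = c (List.ofFn (l a₀ ∘ e.symm) ++ u j)
        rw [← hmono a _ (hu j (by omega)), hofFn, hzy, List.map_append, hzmap a]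
        simp [Function.comp_def]
      · obtain ⟨y', hy'⟩ := huy i j (by omega) (by omega)
        exact ⟨y', fun a => by simpa only [List.append_assoc] using hy' a⟩

/-- A finite colouring of words is constant on a left-variable extension of some word,
including the word itself. -/
lemma exists_left_variable_word [Nonempty A] [Finite κ] (c : List A → κ) :
    ∃ (z : List A) (y : List (Option A)), ∀ a, c (z ++ (none :: y).map (·.getD a)) = c z := by
  have := Fintype.ofFinite κ
  obtain ⟨M, hM⟩ := exists_words_chain (A := A) (Fintype.card κ) κ
  obtain ⟨u, -, hu⟩ := hM c
  obtain ⟨i, j, hij, h⟩ := Fintype.exists_ne_map_eq_of_card_lt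
    (fun i : Fin (Fintype.card κ + 1) => c (u i)) (by simp)
  wlog hlt : i < j generalizing i j
  · exact this j i hij.symm h.symm (lt_of_le_of_ne (not_lt.1 hlt) hij.symm)
  obtain ⟨y, hy⟩ := hu i j hlt (by omega)
  exact ⟨u i, y, fun a => (hy a).trans h.symm⟩

end Words

section Substitution

variable {P Q R s t u v X Y Z : Set (Set ℕ)} {a b c j l M N : ℕ} {F K : Set (Set (Set ℕ))}
  {w w' : List ℕ}

/-- The `l`-th block minimum of `X` that is at least `N`. -/
noncomputable def newMin (X : Set (Set ℕ)) (N l : ℕ) : ℕ :=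
  Nat.nth (fun x => N ≤ x ∧ IsBlockMin X x) l

open Classical in
/-- Send `a` to the minimum of its block in `X` if this is below `N`, and to the letter of `w`
that belongs to its block otherwise. -/
noncomputable def wordMap (X : Set (Set ℕ)) (N : ℕ) (w : List ℕ) (a : ℕ) : ℕ :=
  if blockMin X a < N then blockMin X a
  else w.getD (Nat.count (fun x => N ≤ x ∧ IsBlockMin X x) (blockMin X a)) 0

lemma InfPart.infinite_newMin (hX : InfPart X) (N : ℕ) :
    (Set.ofPred fun x => N ≤ x ∧ IsBlockMin X x).Infinite := by
  rw [Set.infinite_iff_exists_gt]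
  intro n
  obtain ⟨m, hm, hmin⟩ := hX.exists_isBlockMin (max N (n + 1))
  exact ⟨m, ⟨by omega, hmin⟩, by omega⟩

lemma InfPart.le_newMin (hX : InfPart X) (N l : ℕ) : N ≤ newMin X N l :=
  (Nat.nth_mem_of_infinite (hX.infinite_newMin N) l).1

lemma InfPart.isBlockMin_newMin (hX : InfPart X) (N l : ℕ) : IsBlockMin X (newMin X N l) :=
  (Nat.nth_mem_of_infinite (hX.infinite_newMin N) l).2

lemma InfPart.newMin_strictMono (hX : InfPart X) (N : ℕ) : StrictMono (newMin X N) :=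
  Nat.nth_strictMono (hX.infinite_newMin N)

lemma InfPart.wordMap_eq (hX : InfPart X) (h : sameBlock X a b) :
    wordMap X N w a = wordMap X N w b := by
  rw [wordMap, wordMap, hX.blockMin_eq h]

lemma InfPart.wordMap_newMin (hX : InfPart X) : wordMap X N w (newMin X N l) = w.getD l 0 := by
  classical
  rw [wordMap, (hX.isBlockMin_newMin N l).blockMin_eq hX, if_neg (not_lt.2 (hX.le_newMin N l)),
    newMin, Nat.count_nth_of_infinite (hX.infinite_newMin N)]

/-- Below `newMin X N l`, the map given by a word is either the block minimum or a letter. -/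
lemma InfPart.wordMap_cases (hX : InfPart X) (ha : a < newMin X N l) :
    (∃ b < N, sameBlock X a b ∧ ∀ w, wordMap X N w a = b) ∨
      ∃ j < l, ∀ w : List ℕ, wordMap X N w a = w.getD j 0 := by
  classical
  have hle := hX.blockMin_le_self a
  by_cases h : blockMin X a < N
  · exact Or.inl ⟨_, h, hX.sameBlock_blockMin a, fun w => if_pos h⟩
  · refine Or.inr ⟨Nat.count (fun x => N ≤ x ∧ IsBlockMin X x) (blockMin X a), ?_,
      fun w => if_neg h⟩
    rw [← (hX.newMin_strictMono N).lt_iff_lt, newMin,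
      Nat.nth_count (p := fun x => N ≤ x ∧ IsBlockMin X x) ⟨not_lt.1 h, hX.isBlockMin_blockMin a⟩]
    omega

lemma InfPart.sameBlock_wordMap (hX : InfPart X) (ha : a < N) :
    wordMap X N w a < N ∧ sameBlock X a (wordMap X N w a) := by
  classical
  have h : blockMin X a < N := (hX.blockMin_le_self a).trans_lt ha
  rw [wordMap, if_pos h]
  exact ⟨h, hX.sameBlock_blockMin a⟩

lemma wordMap_lt (hNM : N ≤ M) (hM : 0 < M) (hw : ∀ x ∈ w, x < M)
    (a : ℕ) : wordMap X N w a < M := by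
  classical
  rw [wordMap]
  split_ifs with h
  · omega
  · rw [List.getD_eq_getElem?_getD]
    cases hx : w[Nat.count (fun x => N ≤ x ∧ IsBlockMin X x) (blockMin X a)]? with
    | none => exact hM
    | some x => exact hw x (List.mem_of_getElem? hx)

/-- Filling in letters yields a segment of `X`. -/
lemma sStar_fill_coarser (hX : InfPart X) (hv : FinPart v) (hNv : N ≤ finBound v)
    (h0 : 0 < finBound v) (hw : ∀ x ∈ w, x < finBound v) :
    Coarser (sStar (fill v (wordMap X N w) (newMin X N l))) X := by
  have hh : ∀ a < newMin X N l, wordMap X N w a < finBound v :=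
    fun a _ => wordMap_lt hNv h0 hw a
  rw [sStar_coarser_iff (finPart_fill hv hh) hX, finBound_fill hv hh]
  refine ⟨hX.isBlockMin_newMin N l, fun a ha b hb hab => ?_⟩
  rw [sameBlock_fill hv hh, ← hX.wordMap_eq hab]
  exact ⟨ha, hb, hv.refl (hh a ha)⟩

/-- If `v` absorbs the blocks of `X` below `N`, filling in letters prolongs `v`. -/
lemma ext_fill_wordMap (hX : InfPart X) (hv : FinPart v) (h0 : 0 < finBound v)
    (hXv : ∀ a < finBound v, ∀ b < finBound v, sameBlock X a b → sameBlock v a b)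
    (hw : ∀ x ∈ w, x < finBound v) :
    Ext v (fill v (wordMap X (finBound v) w) (newMin X (finBound v) l)) := by
  refine ext_fill hv (fun a _ => wordMap_lt le_rfl h0 hw a) (hX.le_newMin _ _) fun a ha => ?_
  obtain ⟨h1, h2⟩ := hX.sameBlock_wordMap (w := w) ha
  exact hXv a ha _ h1 h2

lemma exists_fill_mem (hs : FinPart s) (h0 : 0 < finBound s) (ht : FinPart t)
    (hst : Segment s t) (hX : InfPart X) (htX : Segment t X)
    (huniv : ∀ u ∈ nseg t X t.ncard, ∃ v ∈ iseg0 s u, v ∈ K) (hw : ∀ x ∈ w, x < finBound s) :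
    ∃ v ∈ iseg0 s t, fill v (wordMap X (finBound t) w) (newMin X (finBound t) l) ∈ K := by
  have hle := hst.le hs ht
  have hwt : ∀ x ∈ w, x < finBound t := fun x hx => (hw x hx).trans_le hle
  set h := wordMap X (finBound t) w with hdef
  set m := newMin X (finBound t) l
  have hm : finBound t ≤ m := hX.le_newMin _ _
  have hh : ∀ a, h a < finBound t := fun a => wordMap_lt le_rfl (by omega) hwt a
  have hXt : ∀ a < finBound t, ∀ b < finBound t, sameBlock X a b → sameBlock t a b :=
    fun a ha b hb hab => (htX.iff ht hX.1 ha hb).2 hab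
  have hext : Ext t (fill t h m) := ext_fill_wordMap hX ht (by omega) hXt hwt
  have hbd : finBound (fill t h m) = m := finBound_fill ht fun a _ => hh a
  obtain ⟨v', hv', hv'K⟩ := huniv _ ((mem_nseg_iff ht).2
    ⟨hext, sStar_fill_coarser hX ht le_rfl (by omega) hwt⟩)
  rw [mem_iseg0_iff hs hext.fin, hbd] at hv'
  obtain ⟨hsv', hv'm, hle'⟩ := hv'
  have hr := equivOn_restrict (P := v') (N := finBound t) hsv'.fin.1 (by
    rw [hsv'.fin.pdom_eq, hv'm]
    exact Set.Iio_subset_Iio hm)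
  set v := mkPart (Set.Iio (finBound t)) (sameBlock v') with hvdef
  have hv : FinPart v := finPart_mkPart hr
  have hvb : finBound v = finBound t := finBound_mkPart hr
  have hvs : ∀ a b, sameBlock v a b ↔ a < finBound t ∧ b < finBound t ∧ sameBlock v' a b :=
    fun a b => sameBlock_mkPart hr
  have hhv : ∀ a < m, h a < finBound v := fun a _ => hvb ▸ hh a
  refine ⟨v, ?_, ?_⟩
  · rw [mem_iseg0_iff hs ht]
    refine ⟨⟨hs, hv, ?_, ?_⟩, hvb, fun a b hab => ?_⟩
    · rw [hs.segment_iff hv, hvb]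
      refine ⟨hle, fun a ha b hb => ?_⟩
      rw [hvs, hsv'.seg.iff hs hsv'.fin.1 ha hb]
      exact ⟨fun h => ⟨by omega, by omega, h⟩, fun h => h.2.2⟩
    · rw [hvb]
      intro a ha
      obtain ⟨b, hb, hab⟩ := hsv'.old a (by omega)
      exact ⟨b, hb, (hvs _ _).2 ⟨ha, by omega, hab⟩⟩
    · have := ht.lt hab
      exact (hvs _ _).2 ⟨this.1, this.2, hle' _ _ (hext.seg.mono ht hext.fin.1 hab)⟩
  · have hself : ∀ a < m, sameBlock v' a (h a) := by
      intro a ha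
      refine hle' _ _ ((sameBlock_fill ht fun a _ => hh a).2 ⟨ha, (hh a).trans_le hm, ?_⟩)
      obtain ⟨h1, h2⟩ := hX.sameBlock_wordMap (w := w) (hh a)
      exact hXt _ (hh a) _ h1 h2
    have : fill v h m = v' := by
      refine (finPart_fill hv hhv).eq_of_sameBlock_iff hsv'.fin ?_ fun a ha b hb => ?_
      · rw [finBound_fill hv hhv, hv'm]
      · rw [finBound_fill hv hhv] at ha hb
        rw [sameBlock_fill hv hhv, hvs]
        have ha' := hself a ha
        have hb' := hself b hb
        exact ⟨fun h => hsv'.fin.1.trans ha' (hsv'.fin.1.trans h.2.2.2.2 hb'.symm), fun h =>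
          ⟨ha, hb, hh a, hh b, hsv'.fin.1.trans ha'.symm (hsv'.fin.1.trans h hb')⟩⟩
    rwa [this]

/-- A family that meets `iseg0 s u` for all prolongations `u` of `t` contains some `u` over `s`
together with all of `iseg0 s q` for some `q` over `u*`. -/
lemma exists_mem_and_iseg0_subset (hs : FinPart s) (h0 : 0 < finBound s) (ht : FinPart t)
    (hst : Segment s t) (hX : InfPart X) (htX : Segment t X)
    (huniv : ∀ u ∈ nseg t X t.ncard, ∃ v ∈ iseg0 s u, v ∈ K) :
    ∃ u, Ext s u ∧ Coarser (sStar u) X ∧ u ∈ K ∧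
      ∃ q, Ext (sStar u) q ∧ Coarser (sStar q) X ∧ iseg0 s q ⊆ K := by
  classical
  have hle := hst.le hs ht
  set N := finBound t with hN
  set n := finBound s with hn
  have : Nonempty (Fin n) := ⟨⟨0, h0⟩⟩
  have : Finite (iseg0 s t) := (finite_iseg0 ht).to_subtype
  have hletter : ∀ w : List (Fin n), ∀ x ∈ w.map Fin.val, x < n := by
    intro w x hx
    obtain ⟨i, -, rfl⟩ := List.mem_map.1 hx
    exact i.2
  have hcol : ∀ w : List (Fin n), ∃ v : iseg0 s t,
      fill v (wordMap X N (w.map Fin.val)) (newMin X N w.length) ∈ K := by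
    intro w
    obtain ⟨v, hv, h⟩ := exists_fill_mem (l := w.length) hs h0 ht hst hX htX huniv (hletter w)
    exact ⟨⟨v, hv⟩, h⟩
  choose c hc using hcol
  obtain ⟨z, y, hzy⟩ := exists_left_variable_word c
  obtain ⟨⟨v, hv⟩, hvz⟩ : ∃ v, c z = v := ⟨_, rfl⟩
  simp only [hvz] at hzy
  have huK := hc z
  rw [hvz] at huK
  rw [mem_iseg0_iff hs ht, ← hN] at hv
  obtain ⟨hsv, hvN, htv⟩ := hv
  have hXv : ∀ a < finBound v, ∀ b < finBound v, sameBlock X a b → sameBlock v a b := by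
    rw [hvN]
    exact fun a ha b hb hab => htv _ _ ((htX.iff ht hX.1 ha hb).2 hab)
  set m := newMin X N z.length with hm
  have hNm : N ≤ m := hX.le_newMin _ _
  set hz := wordMap X N (z.map Fin.val) with hzdef
  have hzlt : ∀ a, hz a < N := fun a => wordMap_lt le_rfl (by omega)
    (fun x hx => (hletter z x hx).trans_le hle) a
  have hzv : ∀ a < m, hz a < finBound v := fun a _ => hvN ▸ hzlt a
  set u := fill v hz m with hu
  have hvu : Ext v u := by
    have := ext_fill_wordMap (w := z.map Fin.val) (l := z.length) hX hsv.fin (by omega) hXv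
      (fun x hx => hvN ▸ (hletter z x hx).trans_le hle)
    rwa [hvN] at this
  have hub : finBound u = m := finBound_fill hsv.fin hzv
  have husb : finBound (sStar u) = m + 1 := by rw [finBound_sStar hvu.fin, hub]
  set W : List (Option (Fin n)) := z.map some ++ none :: y with hW
  set k := wordMap X N (W.map fun o => o.elim m Fin.val) with hk
  have hklt : ∀ a, k a < m + 1 := by
    refine fun a => wordMap_lt (by omega) (by omega) (fun x hx => ?_) a
    obtain ⟨o, -, rfl⟩ := List.mem_map.1 hx
    cases o with
    | none => exact Nat.lt_succ_self m
    | some i =>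
      have := i.2
      change (i : ℕ) < m + 1
      omega
  have hkv : ∀ M, ∀ a < M, k a < finBound (sStar u) := fun _ a _ => husb ▸ hklt a
  set M := newMin X N W.length with hMdef
  have hmM : m < M := hX.newMin_strictMono N (by simp [hW])
  have hkid : ∀ a < finBound (sStar u), sameBlock (sStar u) a (k a) := by
    rw [husb]
    intro a ha
    rw [sameBlock_sStar, hub]
    rcases Nat.lt_succ_iff_lt_or_eq.1 ha with ha | rfl
    · have hkz : k a = hz a := by
        rcases hX.wordMap_cases ha with ⟨b, -, -, hb⟩ | ⟨j, hj, hb⟩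
        · rw [hk, hzdef, hb, hb]
        · rw [hk, hzdef, hb, hb]
          simp [hW, List.getElem?_append_left, hj]
      left
      rw [hkz, hu, sameBlock_fill hsv.fin hzv]
      obtain ⟨h1, h2⟩ := hX.sameBlock_wordMap (w := z.map Fin.val) (hzlt a)
      exact ⟨ha, (hzlt a).trans_le hNm, hXv _ (hzv a ha) _ (hvN ▸ h1) h2⟩
    · right
      rw [hk, hm, hX.wordMap_newMin]
      simp [hW]
  have huq : Ext (sStar u) (fill (sStar u) k M) :=
    ext_fill hvu.fin.sStar (hkv M) (by omega) hkid
  set q := fill (sStar u) k M with hq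
  have hqb : finBound q = M := finBound_fill hvu.fin.sStar (hkv M)
  refine ⟨u, hsv.trans hvu, ?_, huK, q, huq, ?_, fun p hp => ?_⟩
  · exact sStar_fill_coarser hX hsv.fin hvN.ge (by omega)
      (fun x hx => hvN ▸ (hletter z x hx).trans_le hle)
  · refine sStar_fill_coarser hX hvu.fin.sStar (by omega) (by omega) fun x hx => ?_
    rw [husb]
    obtain ⟨o, -, rfl⟩ := List.mem_map.1 hx
    cases o with
    | none => exact Nat.lt_succ_self m
    | some i =>
      have := i.2
      change (i : ℕ) < m + 1
      omega
  · rw [mem_iseg0_iff hs huq.fin, hqb] at hp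
    obtain ⟨hsp, hpM, hqp⟩ := hp
    obtain ⟨α, hα, hmα⟩ := hsp.old m (by omega)
    have hwK := hc (z ++ (none :: y).map (·.getD ⟨α, hα⟩))
    rw [hzy] at hwK
    have hwW : z ++ (none :: y).map (·.getD ⟨α, hα⟩) = W.map (·.getD ⟨α, hα⟩) := by
      simp [hW, Function.comp_def]
    rw [hwW, List.length_map, ← hMdef, List.map_map] at hwK
    set h := wordMap X N (W.map (Fin.val ∘ fun o => o.getD ⟨α, hα⟩)) with hh
    have hhlt : ∀ a, h a < N := by
      refine fun a => wordMap_lt le_rfl (by omega) (fun x hx => ?_) a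
      obtain ⟨o, -, rfl⟩ := List.mem_map.1 hx
      exact (Fin.is_lt _).trans_le hle
    have hhv : ∀ a < M, h a < finBound v := fun a _ => hvN ▸ hhlt a
    have hpself : ∀ a < M, sameBlock p a (h a) := by
      intro a ha
      have hka : sameBlock p a (k a) := by
        have := hklt a
        exact hqp _ _ ((sameBlock_fill hvu.fin.sStar (hkv M)).2
          ⟨ha, by omega, hkid _ (by omega)⟩)
      suffices h' : k a = h a ∨ (k a = m ∧ h a = α) by
        rcases h' with h' | ⟨h1, h2⟩
        · rwa [← h']
        · rw [h2]
          exact hsp.fin.1.trans (h1 ▸ hka) hmα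
      rcases hX.wordMap_cases ha with ⟨b, -, -, hb⟩ | ⟨j, hj, hb⟩
      · left
        rw [hk, hh, hb, hb]
      · rw [hk, hh, hb, hb]
        cases hWj : W[j] with
        | none => simp [hj, hWj]
        | some i => simp [hj, hWj]
    have hvp : ∀ a b, sameBlock v a b → sameBlock p a b := fun a b hab =>
      hqp _ _ (huq.seg.mono hvu.fin.sStar huq.fin.1
        ((segment_sStar hvu.fin).mono hvu.fin hvu.fin.sStar.1 (hvu.seg.mono hsv.fin hvu.fin.1 hab)))
    have : fill v h M = p := by
      refine (finPart_fill hsv.fin hhv).eq_of_sameBlock_iff hsp.fin ?_ fun a ha b hb => ?_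
      · rw [finBound_fill hsv.fin hhv, hpM]
      · rw [finBound_fill hsv.fin hhv] at ha hb
        rw [sameBlock_fill hsv.fin hhv]
        have ha' := hpself a ha
        have hb' := hpself b hb
        exact ⟨fun h => hsp.fin.1.trans ha' (hsp.fin.1.trans (hvp _ _ h.2.2) hb'.symm), fun h =>
          ⟨ha, hb, hsv.sameBlock_of_coarser hsp.fin.1 hsp.seg hvp (hhv a ha) (hhv b hb)
            (hsp.fin.1.trans ha'.symm (hsp.fin.1.trans h hb'))⟩⟩
    rwa [← this]

end Substitution

section Homogeneity

variable {p q s t u v w X Y Z : Set (Set ℕ)} {a b c k n r M N : ℕ} {F K : Set (Set (Set ℕ))}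

lemma nseg_mono (hZ : InfPart Z) (hY : InfPart Y) (h : Coarser Z Y) : nseg s Z n ⊆ nseg s Y n :=
  fun _ hw => ⟨hw.1, hw.2.1, hw.2.2.1, hw.2.2.2.trans h hw.1.sStar.1 hZ hY.1⟩

lemma Dense.mono (hK : Dense F K s Y) (hY : InfPart Y) (hZ : InfPart Z) (h : Coarser Z Y) :
    Dense F K s Z :=
  fun _ hW hWZ => hK _ hW (ellNbhd_trans hY h hZ hWZ)

/-- From a dense set `K` one can pass to a segment in `K` above which `{t | iseg0 s t ⊆ K}` is
dense again. -/
lemma Dense.exists_dense_iseg0 (hF : GameFilter F) (hs : FinPart s) (h0 : 0 < finBound s)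
    (hY : Y ∈ F) (hsY : Coarser s Y) (hK : Dense F K s Y) :
    ∃ u ∈ K, Ext s u ∧ ∃ Z ∈ F, Z ∈ EllNbhd (sStar u) Y ∧
      Dense F {t | iseg0 s t ⊆ K} (sStar u) Z := by
  have hinf := hF.1.1.mem_infPart
  by_contra! hcon
  obtain ⟨Z, hZ, hZY, hgood⟩ := exists_fusion hF hs hY hsY
    (Good := fun u W => u ∈ K → ∀ t ∈ W, t.ncard = (sStar u).ncard → ¬ iseg0 s t ⊆ K)
    (fun u A B hBA h huK t ht => h huK t (hBA ht)) fun u hu Y₁ hY₁ hY₁Y => by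
      by_cases huK : u ∈ K
      · have := hcon u huK hu Y₁ hY₁ hY₁Y
        rw [Dense] at this
        push Not at this
        obtain ⟨Z, hZ, hZY₁, h⟩ := this
        exact ⟨Z, hZ, hZY₁, fun _ t ht hc => h t ⟨ht.1, hc, ht.2⟩⟩
      · exact ⟨Y₁, hY₁, ⟨hY₁Y.1, hY₁Y.2.1, hY₁Y.1.coarser_refl⟩, fun h => absurd h huK⟩
  obtain ⟨t, ht, hst, X, hX, hXZ, huniv⟩ := (hK.mono (hinf Y hY) hZY.1 hZY.2.2).exists_universal
    hF hs hZ (hZY.2.1.coarser hs hZY.1.1)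
  obtain ⟨u, hu, huX, huK, q, hq, hqX, hqK⟩ :=
    exists_mem_and_iseg0_subset hs h0 ht hst hXZ.1 hXZ.2.1 huniv
  exact hgood u ((mem_nseg_iff hs).2 ⟨hu, huX.trans hXZ.2.2 hu.fin.sStar.1 hXZ.1 hZY.1.1⟩) huK q
    ⟨hq.fin, hq.seg, hqX.trans hXZ.2.2 hq.fin.sStar.1 hXZ.1 hZY.1.1⟩ hq.ncard hqK

lemma iseg0_subset_singleton (hu : Ext s u) : iseg0 s u ⊆ {u} := by
  intro w hw
  rw [mem_iseg0_iff hu.base hu.fin] at hw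
  obtain ⟨hw, hd, h⟩ := hw
  exact hw.fin.eq_of_sameBlock_iff hu.fin hd fun a ha b hb =>
    ⟨hu.sameBlock_of_coarser hw.fin.1 hw.seg h (hd ▸ ha) (hd ▸ hb), h a b⟩

/-- Interpolation: a coarsening of `q` over `s` factors through a coarsening over `p`. -/
lemma exists_mem_iseg0_mem_iseg0 (hs : FinPart s) (hp : FinPart p) (hq : FinPart q)
    (hsp : Segment s p) (hpq : Segment p q) (hw : w ∈ iseg0 s q) :
    ∃ w' ∈ iseg0 p q, w ∈ iseg0 s w' := by
  rw [mem_iseg0_iff hs hq] at hw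
  obtain ⟨hw, hd, hqw⟩ := hw
  have hspb := hsp.le hs hp
  have hpqb := hpq.le hp hq
  have hex : ∀ a, ∃ b, a < finBound q → b < finBound p ∧ (sameBlock q a b ∨
      (∀ b' < finBound p, ¬ sameBlock q a b') ∧ b < finBound s ∧ sameBlock w a b) := by
    intro a
    by_cases h : ∃ b < finBound p, sameBlock q a b
    · obtain ⟨b, hb, hab⟩ := h
      exact ⟨b, fun _ => ⟨hb, Or.inl hab⟩⟩
    · push Not at h
      by_cases ha : a < finBound q
      · obtain ⟨b, hb, hab⟩ := hw.old a (hd ▸ ha)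
        exact ⟨b, fun _ => ⟨by omega, Or.inr ⟨h, hb, hab⟩⟩⟩
      · exact ⟨0, fun h => absurd h ha⟩
  choose g hg using hex
  have hlt : ∀ a < finBound q, g a < finBound p := fun a ha => (hg a ha).1
  have hself : ∀ a < finBound q, sameBlock w a (g a) := by
    intro a ha
    rcases (hg a ha).2 with h | h
    · exact hqw _ _ h
    · exact h.2.2
  have hext : Ext p (fill p g (finBound q)) := by
    refine ext_fill hp hlt hpqb fun a ha => ?_
    have haq : a < finBound q := by omega
    rw [hpq.iff hp hq.1 ha (hlt a haq)]
    rcases (hg a haq).2 with h | h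
    · exact h
    · exact absurd (hq.refl haq) (h.1 a ha)
  refine ⟨fill p g (finBound q), ?_, ?_⟩
  · rw [mem_iseg0_iff hp hq]
    refine ⟨hext, finBound_fill hp hlt, fun a b hab => ?_⟩
    obtain ⟨ha, hb⟩ := hq.lt hab
    refine (sameBlock_fill hp hlt).2 ⟨ha, hb, ?_⟩
    rcases (hg a ha).2 with h | ⟨h, hga, hwa⟩ <;> rcases (hg b hb).2 with h' | ⟨h', hgb, hwb⟩
    · exact (hpq.iff hp hq.1 (hlt a ha) (hlt b hb)).2
        (hq.1.trans h.symm (hq.1.trans hab h'))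
    · exact absurd (hq.1.trans hab.symm h) (h' _ (hlt a ha))
    · exact absurd (hq.1.trans hab h') (h _ (hlt b hb))
    · exact hsp.mono hs hp.1 ((hw.seg.iff hs hw.fin.1 hga hgb).2
        (hw.fin.1.trans hwa.symm (hw.fin.1.trans (hqw _ _ hab) hwb)))
  · rw [mem_iseg0_iff hs hext.fin, finBound_fill hp hlt]
    refine ⟨hw, hd, fun a b hab => ?_⟩
    obtain ⟨ha, hb, h⟩ := (sameBlock_fill hp hlt).1 hab
    exact hw.fin.1.trans (hself a ha) (hw.fin.1.trans (hqw _ _ (hpq.mono hp hq.1 h))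
      (hself b hb).symm)

/-- A dense set contains all segments over `s`, with as many blocks as `s`, of some member of
the filter. -/
lemma Dense.exists_subset (hF : GameFilter F) (hs : FinPart s) (h0 : 0 < finBound s)
    (hX : X ∈ F) (hsX : Coarser s X) (hK : Dense F K s X) :
    ∃ Z ∈ F, Z ∈ EllNbhd s X ∧ nseg s Z s.ncard ⊆ K := by
  have hinf := hF.1.1.mem_infPart
  have hout := exists_outcome hF hs hX
    (fun u Y => iseg0 s u ⊆ K ∧ Dense F {t | iseg0 s t ⊆ K} (sStar u) Y) ?_ ?_
  · obtain ⟨Z, hZ, hZX, h⟩ := hout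
    refine ⟨Z, hZ, hZX, fun u hu => ?_⟩
    obtain ⟨t, Y, -, ⟨ht, -⟩, hut, -⟩ := h u hu
    exact ht hut
  · obtain ⟨u, huK, hu, Z, hZ, hZX, hd⟩ := hK.exists_dense_iseg0 hF hs h0 hX hsX
    exact ⟨u, Z, hu, hZ, hZX, (iseg0_subset_singleton hu).trans (by simpa using huK), hd⟩
  · rintro t Y ht hst hY hYX ⟨-, hdt⟩ X' hX' hX'Y
    obtain ⟨u, huK, hu, Z, hZ, hZX', hd⟩ :=
      (hdt.mono (hinf Y hY) hX'Y.1 hX'Y.2.2).exists_dense_iseg0 hF ht.sStar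
        (by rw [finBound_sStar ht]; omega) hX' (hX'Y.2.1.coarser ht.sStar hX'Y.1.1)
    refine ⟨u, Z, hu, hZ, hZX', huK, fun W hW hWZ => ?_⟩
    obtain ⟨q, hq, hqK⟩ := hd W hW hWZ
    refine ⟨q, hq, fun w hw => ?_⟩
    have htu := hu.seg.trans (segment_sStar hu.fin) ht.sStar hu.fin hu.fin.sStar.1
    obtain ⟨w', hw', hww'⟩ := exists_mem_iseg0_mem_iseg0 hs ht.sStar hq.1
      (hst.trans (segment_sStar ht) hs ht ht.sStar.1)
      (htu.trans hq.2.2.1 ht.sStar hu.fin.sStar hq.1.1) hw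
    exact hqK hw' hww'

/-- Homogeneity for segments over `s` with as many blocks as `s`. -/
lemma exists_homogeneous_ncard (hF : GameFilter F) (hs : FinPart s) (h0 : 0 < finBound s)
    (π : Set (Set ℕ) → ℕ) (hX : X ∈ F) (hsX : Coarser s X)
    (hπ : ∀ u ∈ nseg s X s.ncard, π u < r) :
    ∃ Y ∈ F, Y ∈ EllNbhd s X ∧
      ∀ u ∈ nseg s Y s.ncard, ∀ v ∈ nseg s Y s.ncard, π u = π v := by
  have hinf := hF.1.1.mem_infPart
  induction r generalizing X with
  | zero =>
    obtain ⟨Y, hY, hYX⟩ := exists_mem_ellNbhd hF.1 hX hs hsX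
    obtain ⟨u, hu, huY⟩ := exists_ext_segment hYX.1 hs hYX.2.1
    have := hπ u ((mem_nseg_iff hs).2 ⟨hu, (huY.coarser hu.fin.sStar hYX.1.1).trans hYX.2.2
      hu.fin.sStar.1 hYX.1 (hinf X hX).1⟩)
    omega
  | succ r ih =>
    by_cases hd : Dense F {u | π u = r} s X
    · obtain ⟨Z, hZ, hZX, h⟩ := hd.exists_subset hF hs h0 hX hsX
      exact ⟨Z, hZ, hZX, fun u hu v hv => (h hu).trans (h hv).symm⟩
    · rw [Dense] at hd
      push Not at hd
      obtain ⟨Z, hZ, hZX, h⟩ := hd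
      obtain ⟨Y, hY, hYZ, hhom⟩ := ih hZ (hZX.2.1.coarser hs hZX.1.1) fun u hu => by
        have h1 := hπ u (nseg_mono hZX.1 (hinf X hX) hZX.2.2 hu)
        have h2 : π u ≠ r := h u hu
        omega
      exact ⟨Y, hY, ellNbhd_trans (hinf X hX) hZX.2.2 hZX.1 hYZ, hhom⟩

lemma finBound_pos (hs : FinPart s) (h : s.ncard ≠ 0) : 0 < finBound s := by
  obtain ⟨x, hx⟩ := Set.nonempty_of_ncard_ne_zero h
  obtain ⟨a, ha⟩ := hs.1.1 x hx
  have : a ∈ pdom s := ⟨x, hx, ha⟩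
  rw [hs.mem_pdom] at this
  omega

/-- Homogeneity for segments over `s` with `k` new blocks. -/
lemma exists_homogeneous (hF : GameFilter F) (hs : FinPart s) (hX : X ∈ F) (hsX : Coarser s X)
    (hk : 1 ≤ s.ncard + k) (hr : 1 ≤ r) (π : Set (Set ℕ) → ℕ)
    (hπ : ∀ u ∈ nseg s X (s.ncard + k), π u < r) :
    ∃ Y ∈ F, Y ∈ EllNbhd s X ∧
      ∀ u ∈ nseg s Y (s.ncard + k), ∀ v ∈ nseg s Y (s.ncard + k), π u = π v := by
  classical
  have hinf := hF.1.1.mem_infPart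
  induction k generalizing s X with
  | zero => exact exists_homogeneous_ncard hF hs (finBound_pos hs (by omega)) π hX hsX hπ
  | succ k ih =>
    obtain ⟨Z, hZ, hZX, hgood⟩ := exists_fusion hF hs hX hsX
      (Good := fun _ W => ∀ w ∈ W, ∀ w' ∈ W, w.ncard = s.ncard + (k + 1) →
        w'.ncard = s.ncard + (k + 1) → π w = π w')
      (fun u A B hBA h w hw w' hw' => h w (hBA hw) w' (hBA hw')) fun u hu Y hY hYX => by
        have hc : (sStar u).ncard + k = s.ncard + (k + 1) := by
          rw [ncard_sStar hu.fin, hu.ncard]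
          omega
        obtain ⟨Y', hY', hY'Y, h⟩ := ih hu.fin.sStar hY (hYX.2.1.coarser hu.fin.sStar hYX.1.1)
          (by omega) fun w hw => hπ w ⟨hw.1, hw.2.1.trans hc,
            (hu.seg.trans (segment_sStar hu.fin) hs hu.fin hu.fin.sStar.1).trans hw.2.2.1
              hs hu.fin.sStar hw.1.1,
            hw.2.2.2.trans hYX.2.2 hw.1.sStar.1 hYX.1 (hinf X hX).1⟩
        exact ⟨Y', hY', hY'Y, fun w hw w' hw' hwc hwc' =>
          h w ⟨hw.1, hwc.trans hc.symm, hw.2⟩ w' ⟨hw'.1, hwc'.trans hc.symm, hw'.2⟩⟩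
    let col : Set (Set ℕ) → ℕ := fun u =>
      if h : ∃ w ∈ segs (sStar u) Z, w.ncard = s.ncard + (k + 1) then π h.choose else 0
    have hcol : ∀ u ∈ nseg s Z s.ncard, ∀ w ∈ segs (sStar u) Z, w.ncard = s.ncard + (k + 1) →
        π w = col u := by
      intro u hu w hw hc
      have h : ∃ w ∈ segs (sStar u) Z, w.ncard = s.ncard + (k + 1) := ⟨w, hw, hc⟩
      simp only [col, dif_pos h]
      exact hgood u hu w hw _ h.choose_spec.1 hc h.choose_spec.2
    have hcolr : ∀ u ∈ nseg s Z s.ncard, col u < r := by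
      intro u hu
      by_cases h : ∃ w ∈ segs (sStar u) Z, w.ncard = s.ncard + (k + 1)
      · obtain ⟨w, hw, hc⟩ := h
        rw [← hcol u hu w hw hc]
        exact hπ w ⟨hw.1, hc, (hu.2.2.1.trans (segment_sStar hu.1) hs hu.1 hu.1.sStar.1).trans
          hw.2.1 hs hu.1.sStar hw.1.1, hw.2.2.trans hZX.2.2 hw.1.sStar.1 hZX.1 (hinf X hX).1⟩
      · simp only [col, dif_neg h]
        omega
    obtain ⟨Y, hY, hYZ, hhom⟩ : ∃ Y ∈ F, Y ∈ EllNbhd s Z ∧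
        ∀ u ∈ nseg s Y s.ncard, ∀ v ∈ nseg s Y s.ncard, col u = col v := by
      by_cases h : s.ncard = 0
      · refine ⟨Z, hZ, ⟨hZX.1, hZX.2.1, hZX.1.coarser_refl⟩, fun u hu v hv => ?_⟩
        rw [(Set.ncard_eq_zero hu.1.finite).1 (hu.2.1.trans h),
          (Set.ncard_eq_zero hv.1.finite).1 (hv.2.1.trans h)]
      · exact exists_homogeneous_ncard hF hs (finBound_pos hs h) col hZ
          (hZX.2.1.coarser hs hZX.1.1) hcolr
    refine ⟨Y, hY, ellNbhd_trans (hinf X hX) hZX.2.2 hZX.1 hYZ, ?_⟩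
    have key : ∀ w ∈ nseg s Y (s.ncard + (k + 1)), ∃ u ∈ nseg s Y s.ncard, π w = col u := by
      intro w hw
      obtain ⟨u, hu, huw⟩ := exists_ext_of_ncard_lt hs hw.1 hw.2.2.1 (by rw [hw.2.1]; omega)
      have huY := (mem_nseg_iff hs).2
        ⟨hu, sStar_coarser_of_segment hu.fin hw.1 hYZ.1 huw hw.2.2.2⟩
      exact ⟨u, huY, hcol u (nseg_mono hYZ.1 hZX.1 hYZ.2.2 huY) w
        ⟨hw.1, huw, hw.2.2.2.trans hYZ.2.2 hw.1.sStar.1 hYZ.1 hZX.1.1⟩ hw.2.1⟩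
    intro w hw w' hw'
    obtain ⟨u, hu, h⟩ := key w hw
    obtain ⟨u', hu', h'⟩ := key w' hw'
    rw [h, h', hhom u hu u' hu']

end Homogeneity

/-- Every game filter is an scp-filter. -/
theorem game_filter_scp (F : Set (Set (Set ℕ))) (hF : GameFilter F) :
    IsPFilter F ∧ HasSCP F := by
  refine ⟨hF.1.1, fun s hs X hX hsX k r hk hr π hπ => ?_⟩
  obtain ⟨Y, hY, hYX, h⟩ := exists_homogeneous hF hs hX hsX hk hr π hπ
  exact ⟨Y, hYX, hY, h⟩

end DualRamsey
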